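/- For every ε > 0 there exists a constant c such that the following holds for all integers d ≥ 1, m ≥ 1, and every finite field F with |F| ≥ c·d. If f : F^m → F and a family {P_{x,h}} of univariate polynomials over F of degree at most d, indexed by pairs (x,h) ∈ F^m × F^m, satisfy Pr_{x,h,t}[P_{x,h}(t) ≠ f(x + t·h)] = δ with δ ≤ 1/8 - ε, then there exists a function g : F^m → F that is the evaluation of a polynomial of total degree at most d with d(f,g) ≤ 2δ. -/

import Mathlib

section BivariateDegree

open Polynomial Polynomial.Bivariate

variable {F : Type*} [Field F]

theorem coeff_coeff_swap (p : F[X][Y]) (m n : ℕ) :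
    ((swap p).coeff m).coeff n = (p.coeff n).coeff m := by
  induction p using Polynomial.induction_on' with
  | add p q hp hq => simp [hp, hq]
  | monomial k f =>
    induction f using Polynomial.induction_on' with
    | add f g hf hg => simp [map_add, hf, hg]
    | monomial l r =>
      rw [swap_monomial_monomial]
      simp only [coeff_monomial]
      by_cases h1 : k = n <;> by_cases h2 : l = m <;> simp [h1, h2, coeff_monomial]

theorem map_eval_swap (p : F[X][Y]) (y : F) :
    (swap p).map (evalRingHom y) = p.eval (C y) := by
  induction p using Polynomial.induction_on' with
  | add p q hp hq => simp [hp, hq]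
  | monomial k f =>
    have : (evalRingHom y).comp C = RingHom.id F := by ext; simp
    rw [swap_monomial, Polynomial.map_mul, Polynomial.map_map, this]
    simp

theorem eval_map_eval (p : F[X][Y]) (x y : F) :
    (p.map (evalRingHom x)).eval y = p.evalEval x y := by
  rw [map_evalRingHom_eval]

theorem evalEval_swap (p : F[X][Y]) (x y : F) :
    (swap p).evalEval x y = p.evalEval y x := by
  rw [← eval_map_eval, map_eval_swap]

/-- The polynomials `p(X, Y)` of degree less than `M` in `X` and less than `N` in `Y`. -/
noncomputable def bidegreeLT (F : Type*) [Field F] (M N : ℕ) : Submodule F F[X][Y] :=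
  (degreeLT F[X] N).restrictScalars F ⊓
    ((degreeLT F[X] M).restrictScalars F).comap (swap (R := F)).toLinearMap

theorem mem_bidegreeLT {M N : ℕ} {p : F[X][Y]} :
    p ∈ bidegreeLT F M N ↔ p.degree < N ∧ (swap p).degree < M := by
  simp [bidegreeLT, mem_degreeLT]

theorem mem_bidegreeLT_iff_coeff {M N : ℕ} {p : F[X][Y]} :
    p ∈ bidegreeLT F M N ↔ ∀ n m, N ≤ n ∨ M ≤ m → (p.coeff n).coeff m = 0 := by
  rw [mem_bidegreeLT, degree_lt_iff_coeff_zero, degree_lt_iff_coeff_zero]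
  constructor
  · rintro ⟨h1, h2⟩ n m (h | h)
    · simp [h1 n h]
    · rw [← coeff_coeff_swap, h2 m h, coeff_zero]
  · intro h
    refine ⟨fun n hn => ?_, fun m hm => ?_⟩
    · ext m; simpa using h n m (Or.inl hn)
    · ext n; rw [coeff_coeff_swap]; simpa using h n m (Or.inr hm)

/-- A polynomial in `bidegreeLT F M N` is its array of coefficients. -/
noncomputable def bidegreeLTEquiv (F : Type*) [Field F] (M N : ℕ) :
    bidegreeLT F M N ≃ₗ[F] (Fin N → Fin M → F) where
  toFun p n m := ((p : F[X][Y]).coeff n).coeff m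
  map_add' p q := by ext; simp
  map_smul' a p := by ext; simp
  invFun f := ⟨∑ n : Fin N, ∑ m : Fin M, monomial (n : ℕ) (monomial (m : ℕ) (f n m)), by
    refine Submodule.sum_mem _ fun n _ => Submodule.sum_mem _ fun m _ => ?_
    rw [mem_bidegreeLT_iff_coeff]
    rintro n' m' (h | h)
    · rw [coeff_monomial, if_neg (by omega), coeff_zero]
    · rw [coeff_monomial]
      split_ifs
      · rw [coeff_monomial, if_neg (by omega)]
      · simp⟩
  left_inv p := by
    obtain ⟨p, hp⟩ := p
    rw [mem_bidegreeLT_iff_coeff] at hp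
    ext n m
    simp only [finsetSum_coeff, coeff_monomial,
      apply_ite (fun q : F[X] => q.coeff m), coeff_zero]
    by_cases hn : n < N
    · rw [Finset.sum_eq_single (⟨n, hn⟩ : Fin N)]
      · simp only [if_true]
        by_cases hm : m < M
        · rw [Finset.sum_eq_single (⟨m, hm⟩ : Fin M)]
          · simp
          · intro b _ hb
            rw [if_neg]
            intro h; exact hb (Fin.ext h)
          · simp
        · rw [hp n m (Or.inr (by omega))]
          refine Finset.sum_eq_zero fun b _ => ?_
          rw [if_neg (by omega)]
      · intro b _ hb
        refine Finset.sum_eq_zero fun c _ => ?_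
        rw [if_neg]
        intro h; exact hb (Fin.ext h)
      · simp
    · rw [hp n m (Or.inl (by omega))]
      refine Finset.sum_eq_zero fun b _ => ?_
      refine Finset.sum_eq_zero fun c _ => ?_
      rw [if_neg (by omega)]
  right_inv f := by
    ext n m
    simp only [finsetSum_coeff, coeff_monomial,
      apply_ite (fun q : F[X] => q.coeff m), coeff_zero]
    rw [Finset.sum_eq_single n]
    · rw [Finset.sum_eq_single m]
      · simp
      · intro b _ hb
        rw [if_pos rfl, if_neg]
        intro h; exact hb (Fin.ext h)
      · simp
    · intro b _ hb
      refine Finset.sum_eq_zero fun c _ => ?_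
      rw [if_neg]
      intro h; exact hb (Fin.ext h)
    · simp

instance (M N : ℕ) : FiniteDimensional F (bidegreeLT F M N) :=
  (bidegreeLTEquiv F M N).symm.finiteDimensional

instance (M N : ℕ) : Module.Free F (bidegreeLT F M N) :=
  Module.Free.of_equiv (bidegreeLTEquiv F M N).symm

theorem finrank_bidegreeLT (M N : ℕ) : Module.finrank F (bidegreeLT F M N) = M * N := by
  rw [(bidegreeLTEquiv F M N).finrank_eq, Module.finrank_pi_fintype]
  simp [mul_comm]

theorem degree_mul_lt_of_lt_of_natDegree_le {R : Type*} [CommRing R] {p q : R[X]} {N b : ℕ}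
    (hp : p.degree < N) (hq : q.natDegree ≤ b) : (p * q).degree < (N + b : ℕ) := by
  refine (degree_mul_le p q).trans_lt ?_
  have hq' : q.degree ≤ b := natDegree_le_iff_degree_le.1 hq
  push_cast
  calc p.degree + q.degree ≤ p.degree + b := by gcongr
    _ < N + b := WithBot.add_lt_add_right (by simp) hp

theorem mul_mem_bidegreeLT {M N a b : ℕ} {p q : F[X][Y]} (hp : p ∈ bidegreeLT F M N)
    (ha : (swap q).natDegree ≤ a) (hb : q.natDegree ≤ b) :
    p * q ∈ bidegreeLT F (M + a) (N + b) := by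
  rw [mem_bidegreeLT] at hp ⊢
  refine ⟨degree_mul_lt_of_lt_of_natDegree_le hp.1 hb, ?_⟩
  rw [map_mul]
  exact degree_mul_lt_of_lt_of_natDegree_le hp.2 ha

theorem card_map_eval_eq_zero_le [DecidableEq F] (p : F[X][Y]) (hp : p ≠ 0) (s : Finset F)
    (hs : ∀ x ∈ s, p.map (evalRingHom x) = 0) : s.card ≤ (swap p).natDegree := by
  have hsp : swap p ≠ 0 := by simpa using hp
  have hp2 : (swap p).map (RingHom.id _) ≠ 0 := by simpa using hsp
  have : (s.image (C : F → F[X])).card ≤ (swap p).natDegree := by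
    refine Polynomial.card_le_degree_of_subset_roots (p := swap p) ?_
    intro y hy
    simp only [Finset.image_val, Multiset.mem_dedup, Multiset.mem_map] at hy
    obtain ⟨x, hx, rfl⟩ := hy
    rw [mem_roots hsp, IsRoot.def, ← map_eval_swap, swap_swap_apply]
    exact hs x hx
  rwa [Finset.card_image_of_injective _ C_injective] at this

end BivariateDegree

section DivisionLemma

open Polynomial Polynomial.Bivariate

variable {F : Type*} [Field F]

theorem degree_map_eval_lt {M N : ℕ} {p : F[X][Y]} (hp : p ∈ bidegreeLT F M N) (x : F) :
    (p.map (evalRingHom x)).degree < N :=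
  degree_map_le.trans_lt (mem_bidegreeLT.1 hp).1

theorem degree_C_mul_lt {R : Type*} [CommRing R] {p : R[X]} {N : ℕ} (hp : p.degree < N) (a : R) :
    (C a * p).degree < N := by
  rw [mul_comm]
  simpa using degree_mul_lt_of_lt_of_natDegree_le (q := C a) hp (natDegree_C a).le

theorem finrank_add_finrank_le_of_comp_eq_zero {U V W : Type*} [AddCommGroup U] [Module F U]
    [AddCommGroup V] [Module F V] [AddCommGroup W] [Module F W] [FiniteDimensional F V]
    (f : U →ₗ[F] V) (g : V →ₗ[F] W) (hf : Function.Injective f) (hg : Function.Surjective g)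
    (h : ∀ u, g (f u) = 0) :
    Module.finrank F U + Module.finrank F W ≤ Module.finrank F V := by
  rw [← LinearMap.finrank_range_add_finrank_ker g, LinearMap.range_eq_top.2 hg, finrank_top,
    add_comm]
  refine Nat.add_le_add_left ?_ _
  rw [← LinearMap.finrank_range_of_inj hf]
  refine Submodule.finrank_mono ?_
  rintro _ ⟨u, rfl⟩
  exact h u

/-- A form of Bézout's bound: if `E` and `P` have no common factor and `E(x, Y)` divides `P(x, Y)`
with quotient of degree at most `k`, for all `x ∈ s`, then `s` is small. -/
theorem card_mul_natDegree_le [DecidableEq F] {E P : F[X][Y]} (hrel : IsRelPrime E P) {a k : ℕ}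
    (hEa : (swap E).natDegree ≤ a) (hPb : P.natDegree ≤ E.natDegree + k)
    (hPa : (swap P).natDegree ≤ a + k) (s : Finset F) (r : F → F[X])
    (hr : ∀ x ∈ s, (r x).natDegree ≤ k)
    (hs : ∀ x ∈ s, P.map (evalRingHom x) = E.map (evalRingHom x) * r x) :
    s.card * E.natDegree ≤ 2 * a * E.natDegree + k * (a + E.natDegree) := by
  obtain hb | hb := Nat.eq_zero_or_pos E.natDegree
  · simp [hb]
  generalize hbE : E.natDegree = b at *
  have hE0 : E ≠ 0 := by rintro rfl; simp at hbE; omega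
  set l := s.card with hl
  let Θ : (bidegreeLT F (l + 2 * a + k) (2 * b + k) × (s → degreeLT F (b + k))) →ₗ[F]
      (s → degreeLT F (2 * b + k)) :=
    { toFun := fun g i => ⟨(g.1 : F[X][Y]).map (evalRingHom (i : F)) -
          (g.2 i : F[X]) * E.map (evalRingHom (i : F)), by
        refine Submodule.sub_mem _ ?_ ?_
        · exact mem_degreeLT.2 (degree_map_eval_lt g.1.2 _)
        · rw [mem_degreeLT]
          have := degree_mul_lt_of_lt_of_natDegree_le (mem_degreeLT.1 (g.2 i).2)
            ((natDegree_map_le (f := evalRingHom (i : F)) (p := E)).trans hbE.le)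
          rwa [show b + k + b = 2 * b + k by ring] at this⟩
      map_add' := fun g h => by
        ext1 i
        apply Subtype.ext
        simp only [Prod.fst_add, Prod.snd_add, Pi.add_apply, Submodule.coe_add,
          Polynomial.map_add]
        ring
      map_smul' := fun c g => by
        ext1 i
        apply Subtype.ext
        simp only [Prod.smul_fst, Prod.smul_snd, Pi.smul_apply, Submodule.coe_smul,
          RingHom.id_apply, smul_sub, smul_mul_assoc]
        congr 1
        ext n
        simp [coeff_map] }
  have hΘ : Function.Surjective Θ := by
    intro t
    let G : F[X][Y] := ∑ i : s, C (Lagrange.basis s id (i : F)) * (t i : F[X]).map C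
    have hG : G ∈ bidegreeLT F (l + 2 * a + k) (2 * b + k) := by
      refine Submodule.sum_mem _ fun i _ => ?_
      rw [mem_bidegreeLT]
      constructor
      · refine degree_C_mul_lt (degree_map_le.trans_lt ?_) _
        exact mem_degreeLT.1 (t i).2
      · rw [map_mul, swap_C, swap_map_C, mul_comm]
        refine degree_C_mul_lt (degree_map_le.trans_lt ?_) _
        rw [Lagrange.degree_basis (v := id) (fun _ _ _ _ h => h) i.2]
        have : 0 < s.card := Finset.card_pos.2 ⟨i, i.2⟩
        exact_mod_cast (by omega : s.card - 1 < l + 2 * a + k)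
    refine ⟨(⟨G, hG⟩, 0), ?_⟩
    ext1 i
    apply Subtype.ext
    have h1 : (evalRingHom (i : F)).comp C = RingHom.id F := by ext; simp
    simp only [Θ, LinearMap.coe_mk, AddHom.coe_mk, Pi.zero_apply, ZeroMemClass.coe_zero,
      zero_mul, sub_zero, G, Polynomial.map_sum, Polynomial.map_mul, map_C, Polynomial.map_map,
      h1, Polynomial.map_id]
    rw [Finset.sum_eq_single i]
    · have := Lagrange.eval_basis_self (v := (id : F → F)) (s := s) (fun _ _ _ _ h => h) i.2
      simp only [id] at this
      simp [this]
    · intro j _ hj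
      have := Lagrange.eval_basis_of_ne (v := (id : F → F)) (s := s) (i := j) (j := i)
        (fun h => hj (Subtype.ext h)) i.2
      simp only [id] at this
      simp [this]
    · simp
  let Ψ : (bidegreeLT F (l + a + k) (b + k) × bidegreeLT F (l + a) b) →ₗ[F]
      (bidegreeLT F (l + 2 * a + k) (2 * b + k) × (s → degreeLT F (b + k))) :=
    { toFun := fun g => (⟨(g.1 : F[X][Y]) * E + (g.2 : F[X][Y]) * P, by
        refine Submodule.add_mem _ ?_ ?_
        · have := mul_mem_bidegreeLT g.1.2 hEa hbE.le
          rwa [show l + a + k + a = l + 2 * a + k by ring,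
            show b + k + b = 2 * b + k by ring] at this
        · have := mul_mem_bidegreeLT g.2.2 hPa hPb
          rwa [show l + a + (a + k) = l + 2 * a + k by ring,
            show b + (b + k) = 2 * b + k by ring] at this⟩,
        fun i => ⟨(g.1 : F[X][Y]).map (evalRingHom (i : F)) +
          (g.2 : F[X][Y]).map (evalRingHom (i : F)) * r i, by
          refine Submodule.add_mem _ ?_ ?_
          · exact mem_degreeLT.2 (degree_map_eval_lt g.1.2 _)
          · exact mem_degreeLT.2 (degree_mul_lt_of_lt_of_natDegree_le
              (degree_map_eval_lt g.2.2 _) (hr i i.2))⟩)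
      map_add' := fun g h => by
        refine Prod.ext (Subtype.ext ?_) (funext fun i => Subtype.ext ?_)
        · simp only [Prod.fst_add, Prod.snd_add, Submodule.coe_add]
          ring
        · simp only [Prod.fst_add, Prod.snd_add, Submodule.coe_add, Pi.add_apply,
            Polynomial.map_add]
          ring
      map_smul' := fun c g => by
        have hsm : ∀ (x : F) (p : F[X][Y]),
            (c • p).map (evalRingHom x) = c • p.map (evalRingHom x) := by
          intro x p; ext n; simp [coeff_map]
        refine Prod.ext (Subtype.ext ?_) (funext fun i => Subtype.ext ?_)
        · simp only [Prod.smul_fst, Prod.smul_snd, Submodule.coe_smul, RingHom.id_apply,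
            smul_add, smul_mul_assoc]
        · simp only [Prod.smul_fst, Prod.smul_snd, Submodule.coe_smul, RingHom.id_apply,
            Pi.smul_apply, hsm, smul_add, smul_mul_assoc] }
  have hΨker : ∀ g, Θ (Ψ g) = 0 := by
    intro g
    ext1 i
    apply Subtype.ext
    simp only [Θ, Ψ, LinearMap.coe_mk, AddHom.coe_mk, Pi.zero_apply, ZeroMemClass.coe_zero,
      Polynomial.map_add, Polynomial.map_mul, hs i i.2]
    ring
  have hΨ : Function.Injective Ψ := by
    rw [injective_iff_map_eq_zero]
    rintro ⟨⟨U, hU⟩, ⟨V, hV⟩⟩ h0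
    have h1 : U * E + V * P = 0 := by
      have := congrArg (fun z => ((z.1 : _) : F[X][Y])) h0
      simpa [Ψ] using this
    have hdvd : E ∣ V := by
      refine hrel.dvd_of_dvd_mul_right (z := P) (y := V) ?_
      exact ⟨-U, by linear_combination h1⟩
    have hV0 : V = 0 := by
      refine eq_zero_of_dvd_of_degree_lt hdvd ?_
      rw [degree_eq_natDegree hE0, hbE]
      exact (mem_bidegreeLT.1 hV).1
    subst hV0
    have hU0 : U = 0 := by simpa [hE0] using h1
    subst hU0
    rfl
  have h1 := finrank_add_finrank_le_of_comp_eq_zero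
    (U := bidegreeLT F (l + a + k) (b + k) × bidegreeLT F (l + a) b)
    (V := bidegreeLT F (l + 2 * a + k) (2 * b + k) × (s → degreeLT F (b + k)))
    (W := s → degreeLT F (2 * b + k)) Ψ Θ hΨ hΘ hΨker
  have hdeg : ∀ n, Module.finrank F (degreeLT F n) = n := by
    intro n; rw [(degreeLTEquiv F n).finrank_eq]; simp
  have hprod : ∀ M N M' N', Module.finrank F (bidegreeLT F M N × bidegreeLT F M' N') =
      M * N + M' * N' := by
    intro M N M' N'; rw [Module.finrank_prod, finrank_bidegreeLT, finrank_bidegreeLT]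
  rw [hprod, Module.finrank_prod, finrank_bidegreeLT, Module.finrank_pi_fintype,
    Module.finrank_pi_fintype] at h1
  simp only [hdeg, Finset.sum_const, Finset.card_univ, Fintype.card_coe, smul_eq_mul, ← hl] at h1
  nlinarith

end DivisionLemma

section PolishchukSpielman

open Polynomial Polynomial.Bivariate

variable {F : Type*} [Field F]

theorem exists_ne_zero_evalEval_eq_zero {M N : ℕ} (S : Finset (F × F)) (hS : S.card < M * N) :
    ∃ E ∈ bidegreeLT F M N, E ≠ 0 ∧ ∀ p ∈ S, E.evalEval p.1 p.2 = 0 := by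
  let L : bidegreeLT F M N →ₗ[F] (S → F) :=
    { toFun := fun E p => (E : F[X][Y]).evalEval p.1.1 p.1.2
      map_add' := fun E E' => by ext; simp [evalEval_add]
      map_smul' := fun c E => by ext; simp [evalEval_smul] }
  have hL : LinearMap.ker L ≠ ⊥ := by
    refine LinearMap.ker_ne_bot_of_finrank_lt (V := bidegreeLT F M N) (f := L) ?_
    rw [finrank_bidegreeLT]
    simpa using hS
  obtain ⟨E, hE, hE0⟩ := Submodule.exists_mem_ne_zero_of_ne_bot hL
  refine ⟨E, E.2, by simpa using hE0, fun p hp => ?_⟩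
  exact congrFun (LinearMap.mem_ker.1 hE) ⟨p, hp⟩

theorem exists_natDegree_le_map_eval_eq_mul [Fintype F] [DecidableEq F] {E : F[X][Y]} {a b k : ℕ}
    (ha : (swap E).natDegree ≤ a) (hb : E.natDegree ≤ b) {r c : F → F[X]}
    (hr : ∀ i, (r i).natDegree ≤ k) (hc : ∀ j, (c j).natDegree ≤ k)
    (h : ∀ i j, E.evalEval i j * (r i).eval j = E.evalEval i j * (c j).eval i)
    (han : a + k < Fintype.card F) (hbn : b + k < Fintype.card F) :
    ∃ P : F[X][Y], P.natDegree ≤ b + k ∧ (swap P).natDegree ≤ a + k ∧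
      (∀ i, P.map (evalRingHom i) = E.map (evalRingHom i) * r i) ∧
      ∀ j, (swap P).map (evalRingHom j) = (swap E).map (evalRingHom j) * c j := by
  obtain ⟨J, -, hJ⟩ := Finset.exists_subset_card_eq
    (show b + k + 1 ≤ (Finset.univ : Finset F).card by rw [Finset.card_univ]; omega)
  let P : F[X][Y] := ∑ j ∈ J, (Lagrange.basis J id j).map C *
    C ((swap E).map (evalRingHom j) * c j)
  have hdl (p q : F[X]) (m l : ℕ) (hp : p.natDegree ≤ m) (hq : q.natDegree ≤ l) :
    (p * q).natDegree ≤ m + l := natDegree_mul_le.trans (add_le_add hp hq)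
  have hb' : ∀ j ∈ J, (Lagrange.basis J id j).natDegree ≤ b + k := by
    intro j hj
    rw [natDegree_le_iff_degree_le, Lagrange.degree_basis (v := id) (fun _ _ _ _ h => h) hj, hJ]
    simp
  have hP1 : P.natDegree ≤ b + k := by
    refine natDegree_sum_le_of_forall_le _ _ fun j hj => ?_
    refine (natDegree_mul_C_le _ _).trans ?_
    exact natDegree_map_le.trans (hb' j hj)
  have hP2 : (swap P).natDegree ≤ a + k := by
    simp only [P, map_sum]
    refine natDegree_sum_le_of_forall_le _ _ fun j hj => ?_
    rw [map_mul, swap_map_C, swap_C, mul_comm]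
    refine (natDegree_mul_C_le _ _).trans ?_
    exact natDegree_map_le.trans (hdl _ _ _ _ (natDegree_map_le.trans ha) (hc j))
  have hrow : ∀ i, P.map (evalRingHom i) = E.map (evalRingHom i) * r i := by
    intro i
    refine eq_of_natDegree_lt_card_of_eval_eq' _ _ J ?_ ?_
    · intro j hj
      rw [eval_map_eval, eval_mul, eval_map_eval, h]
      simp only [P, evalEval_finsetSum, evalEval_mul, evalEval_C, eval_mul, eval_map_eval, evalEval_swap,
        evalEval_map_C]
      rw [Finset.sum_eq_single j]
      · have := Lagrange.eval_basis_self (v := (id : F → F)) (s := J) (fun _ _ _ _ h => h) hj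
        simp only [id] at this
        rw [this, one_mul]
      · intro j' _ hj'
        have := Lagrange.eval_basis_of_ne (v := (id : F → F)) (s := J) hj' hj
        simp only [id] at this
        rw [this, zero_mul]
      · exact fun h => absurd hj h
    · rw [hJ, Nat.lt_succ_iff]
      exact max_le (natDegree_map_le.trans hP1) (hdl _ _ _ _ (natDegree_map_le.trans hb) (hr i))
  refine ⟨P, hP1, hP2, hrow, fun j => ?_⟩
  refine eq_of_natDegree_lt_card_of_eval_eq' _ _ Finset.univ (fun i _ => ?_) ?_
  · rw [eval_map_eval, evalEval_swap, ← eval_map_eval, hrow, eval_mul, eval_mul, eval_map_eval,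
      eval_map_eval, evalEval_swap, h]
  · rw [Finset.card_univ]
    refine (max_le ?_ ?_).trans_lt han
    · exact natDegree_map_le.trans hP2
    · exact hdl _ _ _ _ (natDegree_map_le.trans ha) (hc j)

theorem isRelPrime_swap {E P : F[X][Y]} (h : IsRelPrime E P) : IsRelPrime (swap E) (swap P) := by
  intro d h1 h2
  have h1' := map_dvd (swap (R := F)) h1
  have h2' := map_dvd (swap (R := F)) h2
  rw [swap_swap_apply] at h1' h2'
  have := (h h1' h2').map (swap (R := F))
  rwa [swap_swap_apply] at this

theorem eq_zero_and_eq_zero_of_mul_le {a b k x y : ℕ} (h1 : x * b ≤ 2 * a * b + k * (a + b))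
    (h2 : y * a ≤ 2 * b * a + k * (b + a)) (hx : 2 * a + 2 * k < x) (hy : 2 * b + 2 * k < y) :
    b = 0 ∧ a = 0 := by
  rcases le_total a b with hab | hab
  · have hb : b = 0 := by
      by_contra hb
      have h3 := Nat.mul_lt_mul_of_pos_right hx (Nat.pos_of_ne_zero hb)
      have h4 := Nat.mul_le_mul_left k hab
      linarith
    omega
  · have ha : a = 0 := by
      by_contra ha
      have h3 := Nat.mul_lt_mul_of_pos_right hy (Nat.pos_of_ne_zero ha)
      have h4 := Nat.mul_le_mul_left k hab
      linarith
    omega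

/-- A form of the Polishchuk–Spielman lemma. -/
theorem exists_bivariate_of_card_ne_lt [Fintype F] [DecidableEq F] {k e : ℕ} {r c : F → F[X]}
    (hr : ∀ i, (r i).natDegree ≤ k) (hc : ∀ j, (c j).natDegree ≤ k)
    (hS : (Finset.univ.filter fun p : F × F => (r p.1).eval p.2 ≠ (c p.2).eval p.1).card <
      (e + 1) * (e + 1)) (hn : 2 * (e + k) < Fintype.card F) :
    ∃ Q : F[X][Y], Q.natDegree ≤ k ∧ (swap Q).natDegree ≤ k ∧
      (Finset.univ.filter fun i => Q.map (evalRingHom i) ≠ r i).card ≤ e ∧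
      (Finset.univ.filter fun j => (swap Q).map (evalRingHom j) ≠ c j).card ≤ e := by
  obtain ⟨E, hE, hE0, hES⟩ := exists_ne_zero_evalEval_eq_zero _ hS
  rw [mem_bidegreeLT] at hE
  have hsw (p : F[X][Y]) (hp : p ≠ 0) : swap p ≠ 0 := by simpa using hp
  have hEb : E.natDegree ≤ e := by
    have := hE.1
    rw [degree_eq_natDegree hE0] at this
    exact Nat.lt_succ_iff.1 (by exact_mod_cast this)
  have hEa : (swap E).natDegree ≤ e := by
    have := hE.2
    rw [degree_eq_natDegree (hsw _ hE0)] at this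
    exact Nat.lt_succ_iff.1 (by exact_mod_cast this)
  obtain ⟨P, hPb, hPa, hPr, hPc⟩ := exists_natDegree_le_map_eval_eq_mul le_rfl le_rfl hr hc
    (fun i j => by
      by_cases hij : (r i).eval j = (c j).eval i
      · rw [hij]
      · rw [hES (i, j) (by simpa using hij), zero_mul, zero_mul]) (by omega : _ + k < _)
      (by omega : _ + k < _)
  obtain ⟨E', P', W, hrel, hEW, hPW⟩ :=
    UniqueFactorizationMonoid.exists_reduced_factors E hE0 P
  have hW0 : W ≠ 0 := by rintro rfl; exact hE0 (by rw [← hEW, zero_mul])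
  have hE'0 : E' ≠ 0 := by rintro rfl; exact hE0 (by rw [← hEW, mul_zero])
  have hEb' : W.natDegree + E'.natDegree = E.natDegree := by
    rw [← hEW, natDegree_mul hW0 hE'0]
  have hEa' : (swap W).natDegree + (swap E').natDegree = (swap E).natDegree := by
    rw [← hEW, map_mul, natDegree_mul (hsw _ hW0) (hsw _ hE'0)]
  have hPb' : P'.natDegree ≤ E'.natDegree + k := by
    by_cases hP' : P' = 0
    · simp [hP']
    · rw [← hPW, natDegree_mul hW0 hP'] at hPb
      omega
  have hPa' : (swap P').natDegree ≤ (swap E').natDegree + k := by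
    by_cases hP' : P' = 0
    · simp [hP']
    · rw [← hPW, map_mul, natDegree_mul (hsw _ hW0) (hsw _ hP')] at hPa
      omega
  have hrow : ∀ i, W.map (evalRingHom i) ≠ 0 →
      P'.map (evalRingHom i) = E'.map (evalRingHom i) * r i := by
    intro i hi
    apply mul_left_cancel₀ hi
    rw [← mul_assoc, ← Polynomial.map_mul, ← Polynomial.map_mul, hPW, hEW, hPr]
  have hcol : ∀ j, (swap W).map (evalRingHom j) ≠ 0 →
      (swap P').map (evalRingHom j) = (swap E').map (evalRingHom j) * c j := by
    intro j hj
    apply mul_left_cancel₀ hj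
    rw [← mul_assoc, ← Polynomial.map_mul, ← Polynomial.map_mul, ← map_mul, ← map_mul, hPW, hEW,
      hPc]
  have hWrow : (Finset.univ.filter fun i => ¬ W.map (evalRingHom i) ≠ 0).card ≤
      (swap W).natDegree :=
    card_map_eval_eq_zero_le W hW0 _ (by simp)
  have hWcol : (Finset.univ.filter fun i => ¬ (swap W).map (evalRingHom i) ≠ 0).card ≤
      W.natDegree := by
    have := card_map_eval_eq_zero_le (swap W) (hsw _ hW0)
      (Finset.univ.filter fun i => ¬ (swap W).map (evalRingHom i) ≠ 0) (by simp)
    rwa [swap_swap_apply] at this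
  have h1 := card_mul_natDegree_le hrel le_rfl hPb' hPa'
    (Finset.univ.filter fun i => W.map (evalRingHom i) ≠ 0) r (fun i _ => hr i)
    (fun i hi => hrow i (by simpa using hi))
  have h2 := card_mul_natDegree_le (isRelPrime_swap hrel) (by rw [swap_swap_apply]) hPa'
    (by rwa [swap_swap_apply])
    (Finset.univ.filter fun i => (swap W).map (evalRingHom i) ≠ 0) c (fun i _ => hc i)
    (fun i hi => hcol i (by simpa using hi))
  have h3 := Finset.card_filter_add_card_filter_not (s := (Finset.univ : Finset F))
    (fun i => W.map (evalRingHom i) ≠ 0)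
  have h4 := Finset.card_filter_add_card_filter_not (s := (Finset.univ : Finset F))
    (fun i => (swap W).map (evalRingHom i) ≠ 0)
  rw [Finset.card_univ] at h3 h4
  generalize (Finset.univ.filter fun i => W.map (evalRingHom i) ≠ 0).card = x1 at h1 h3
  generalize (Finset.univ.filter fun i => (swap W).map (evalRingHom i) ≠ 0).card = x2 at h2 h4
  have hx1 : 2 * (swap E').natDegree + 2 * k < x1 := by omega
  have hx2 : 2 * E'.natDegree + 2 * k < x2 := by omega
  have hab : E'.natDegree = 0 ∧ (swap E').natDegree = 0 :=
    eq_zero_and_eq_zero_of_mul_le h1 h2 hx1 hx2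
  obtain ⟨p, hp⟩ := natDegree_eq_zero.1 hab.1
  have hp2 : p.natDegree = 0 := by
    have := hab.2
    rwa [← hp, swap_C, natDegree_map] at this
  obtain ⟨u, rfl⟩ := natDegree_eq_zero.1 hp2
  have hu : u ≠ 0 := by rintro rfl; apply hE'0; rw [← hp]; simp
  have hCu : (C u⁻¹ * C u : F[X]) = 1 := by rw [← C_mul, inv_mul_cancel₀ hu, C_1]
  refine ⟨C (C u⁻¹) * P', ?_, ?_, ?_, ?_⟩
  · refine (natDegree_C_mul_le _ _).trans (hPb'.trans ?_)
    omega
  · rw [map_mul, swap_C, map_C]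
    refine (natDegree_C_mul_le _ _).trans (hPa'.trans ?_)
    omega
  · refine le_trans (Finset.card_le_card ?_) (hWrow.trans (by omega))
    intro i
    simp only [Finset.mem_filter, Finset.mem_univ, true_and]
    refine fun hi hW => hi ?_
    rw [Polynomial.map_mul, hrow i hW, ← hp]
    simp [← mul_assoc, hCu]
  · refine le_trans (Finset.card_le_card ?_) (hWcol.trans (by omega))
    intro i
    simp only [Finset.mem_filter, Finset.mem_univ, true_and]
    refine fun hi hW => hi ?_
    rw [map_mul, Polynomial.map_mul, hcol i hW, ← hp, swap_C, swap_C]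
    simp [← mul_assoc, hCu]

end PolishchukSpielman

section Averages

open scoped BigOperators

open Classical in
/-- The real number `1` if `p` holds, and `0` otherwise. -/
noncomputable def ind (p : Prop) : ℝ := if p then 1 else 0

theorem ind_pos {p : Prop} (h : p) : ind p = 1 := if_pos h

theorem ind_neg {p : Prop} (h : ¬ p) : ind p = 0 := if_neg h

theorem ind_nonneg (p : Prop) : 0 ≤ ind p := by
  by_cases h : p <;> simp [ind, h]

theorem ind_le_one (p : Prop) : ind p ≤ 1 := by
  by_cases h : p <;> simp [ind, h]

theorem ind_mono {p q : Prop} (h : p → q) : ind p ≤ ind q := by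
  by_cases hp : p
  · rw [ind_pos (h hp)]; exact ind_le_one p
  · rw [ind_neg hp]; exact ind_nonneg q

theorem ind_congr {p q : Prop} (h : p ↔ q) : ind p = ind q := by rw [propext h]

theorem ind_le_add {p q r : Prop} (h : p → q ∨ r) : ind p ≤ ind q + ind r := by
  by_cases hp : p
  · rcases h hp with h | h
    · linarith [ind_pos h, ind_le_one p, ind_nonneg r]
    · linarith [ind_pos h, ind_le_one p, ind_nonneg q]
  · linarith [ind_neg hp, ind_nonneg q, ind_nonneg r]

theorem ind_le_of_imp {p : Prop} {a : ℝ} (ha : 0 ≤ a) (h : p → 1 ≤ a) : ind p ≤ a := by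
  by_cases hp : p
  · rw [ind_pos hp]; exact h hp
  · rw [ind_neg hp]; exact ha

variable {ι κ : Type*} [Fintype ι] [Fintype κ]

theorem expect_ind_eq (p : ι → Prop) [DecidablePred p] :
    𝔼 i, ind (p i) = (Finset.univ.filter p).card / Fintype.card ι := by
  rw [Fintype.expect_eq_sum_div_card, Finset.natCast_card_filter]
  congr 1
  refine Finset.sum_congr rfl fun i _ => ?_
  by_cases h : p i <;> simp [ind, h]

theorem expect_mono {f g : ι → ℝ} (h : ∀ i, f i ≤ g i) : 𝔼 i, f i ≤ 𝔼 i, g i :=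
  Finset.expect_le_expect fun i _ => h i

theorem expect_nonneg' {f : ι → ℝ} (h : ∀ i, 0 ≤ f i) : 0 ≤ 𝔼 i, f i :=
  Finset.expect_nonneg fun i _ => h i

theorem expect_ind_nonneg (p : ι → Prop) : 0 ≤ 𝔼 i, ind (p i) :=
  expect_nonneg' fun _ => ind_nonneg _

theorem expect_le_const [Nonempty ι] {f : ι → ℝ} {a : ℝ} (h : ∀ i, f i ≤ a) : 𝔼 i, f i ≤ a :=
  Finset.expect_le Finset.univ_nonempty fun i _ => h i

theorem expect_ind_le_one [Nonempty ι] (p : ι → Prop) : 𝔼 i, ind (p i) ≤ 1 :=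
  expect_le_const fun _ => ind_le_one _

theorem exists_le_expect [Nonempty ι] (f : ι → ℝ) : ∃ i, f i ≤ 𝔼 i, f i := by
  obtain ⟨i, -, hi⟩ := Finset.exists_le_of_expect_le (f := f) Finset.univ_nonempty le_rfl
  exact ⟨i, hi⟩

theorem expect_add (f g : ι → ℝ) : 𝔼 i, (f i + g i) = 𝔼 i, f i + 𝔼 i, g i :=
  Finset.expect_add_distrib _ _ _

theorem expect_sub (f g : ι → ℝ) : 𝔼 i, (f i - g i) = 𝔼 i, f i - 𝔼 i, g i :=
  Finset.expect_sub_distrib _ _ _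

theorem expect_const_mul (a : ℝ) (f : ι → ℝ) : 𝔼 i, a * f i = a * 𝔼 i, f i :=
  (Finset.mul_expect _ _ _).symm

theorem expect_swap (f : ι → κ → ℝ) : 𝔼 i, 𝔼 j, f i j = 𝔼 j, 𝔼 i, f i j :=
  Finset.expect_comm _ _ _

theorem expect_prod (f : ι → κ → ℝ) : 𝔼 p : ι × κ, f p.1 p.2 = 𝔼 i, 𝔼 j, f i j := by
  rw [← Finset.univ_product_univ, Finset.expect_product]

theorem expect_ind_eq_const (i : ι) : 𝔼 j, ind (j = i) = (Fintype.card ι : ℝ)⁻¹ := by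
  classical
  have h : (Finset.univ.filter fun j => j = i) = {i} := by ext; simp
  rw [expect_ind_eq, h]
  simp

theorem sq_expect_le (f : ι → ℝ) : (𝔼 i, f i) ^ 2 ≤ 𝔼 i, f i ^ 2 := by
  cases isEmpty_or_nonempty ι
  · simp
  have := Finset.expect_mul_sq_le_sq_mul_sq Finset.univ f (fun _ => (1 : ℝ))
  simpa using this

end Averages

section Shift

open scoped BigOperators

variable {F V : Type*} [Field F] [AddCommGroup V] [Module F V] [Fintype V]

theorem expect_add_const (a : V) (f : V → ℝ) : 𝔼 x, f (x + a) = 𝔼 x, f x :=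
  Fintype.expect_equiv (Equiv.addRight a) _ _ fun _ => rfl

theorem expect_const_add (a : V) (f : V → ℝ) : 𝔼 x, f (a + x) = 𝔼 x, f x :=
  Fintype.expect_equiv (Equiv.addLeft a) _ _ fun _ => rfl

theorem expect_add_smul (a : V) {t : F} (ht : t ≠ 0) (f : V → ℝ) :
    𝔼 h, f (a + t • h) = 𝔼 x, f x := by
  rw [← expect_const_add a f]
  exact Fintype.expect_bijective (fun h => t • h) (MulAction.bijective₀ ht) _ _ fun _ => rfl

/-- Two distinct points of a uniformly random line are independent. -/
theorem expect_expect_add_smul {s t : F} (hst : s ≠ t) (f : V → V → ℝ) :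
    𝔼 x, 𝔼 h, f (x + s • h) (x + t • h) = 𝔼 x, 𝔼 y, f x y := by
  rw [expect_swap]
  have h1 : ∀ h, 𝔼 x, f (x + s • h) (x + t • h) = 𝔼 x, f x (x + (t - s) • h) := by
    intro h
    rw [← expect_add_const (s • h) (fun x => f x (x + (t - s) • h))]
    refine Finset.expect_congr rfl fun x _ => ?_
    rw [sub_smul]
    congr 1
    abel
  simp_rw [h1]
  rw [expect_swap]
  refine Finset.expect_congr rfl fun x _ => ?_
  exact expect_add_smul x (sub_ne_zero.2 hst.symm) (f x)

variable [Fintype F]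

/-- Second moment of the average along a random line. -/
theorem expect_sq_expect_line_le (f : V → ℝ) :
    𝔼 x, 𝔼 h, (𝔼 t : F, f (x + t • h)) ^ 2 ≤
      (𝔼 x, f x) ^ 2 + (Fintype.card F : ℝ)⁻¹ * 𝔼 x, f x ^ 2 := by
  classical
  have hc : (Fintype.card F : ℝ) ≠ 0 := by
    exact_mod_cast Fintype.card_ne_zero
  have h1 : ∀ s t : F, 𝔼 x, 𝔼 h, f (x + s • h) * f (x + t • h) ≤
      (𝔼 x, f x) ^ 2 + ind (t = s) * 𝔼 x, f x ^ 2 := by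
    intro s t
    by_cases hst : t = s
    · subst hst
      rw [ind_pos rfl, one_mul]
      have : 𝔼 x, 𝔼 h, f (x + t • h) * f (x + t • h) = 𝔼 x, f x ^ 2 := by
        rw [expect_swap]
        simp_rw [← sq]
        simp_rw [fun h => expect_add_const (t • h) (fun x => f x ^ 2)]
        rw [Fintype.expect_const]
      rw [this]
      nlinarith [sq_nonneg (𝔼 x, f x)]
    · rw [expect_expect_add_smul (Ne.symm hst) (fun x y => f x * f y), ind_neg hst, zero_mul,
        add_zero, sq, Fintype.expect_mul_expect]
  have h2 : 𝔼 x, 𝔼 h, (𝔼 t : F, f (x + t • h)) ^ 2 =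
      𝔼 s : F, 𝔼 t : F, 𝔼 x, 𝔼 h, f (x + s • h) * f (x + t • h) := by
    simp_rw [sq, Fintype.expect_mul_expect]
    simp_rw [fun x => expect_swap (fun (h : V) (s : F) => 𝔼 t : F, f (x + s • h) * f (x + t • h))]
    rw [expect_swap]
    refine Finset.expect_congr rfl fun s _ => ?_
    simp_rw [fun x => expect_swap (fun (h : V) (t : F) => f (x + s • h) * f (x + t • h))]
    rw [expect_swap]
  rw [h2]
  refine (expect_mono fun s => expect_mono fun t => h1 s t).trans (le_of_eq ?_)
  simp_rw [expect_add, ← Finset.expect_mul, expect_ind_eq_const, Fintype.expect_const]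

end Shift

section Agreement

open Polynomial Polynomial.Bivariate
open scoped BigOperators

variable {F : Type*} [Field F] [Fintype F]

theorem card_field_pos : (0 : ℝ) < Fintype.card F := by
  exact_mod_cast Fintype.card_pos

theorem eq_of_expect_eval_ne {p q : F[X]} {k : ℕ} (hp : p.natDegree ≤ k) (hq : q.natDegree ≤ k)
    (h : Fintype.card F * 𝔼 t, ind (p.eval t ≠ q.eval t) + k < Fintype.card F) : p = q := by
  classical
  rw [expect_ind_eq, mul_div_cancel₀ _ card_field_pos.ne'] at h
  have h1 := Finset.card_filter_add_card_filter_not (s := (Finset.univ : Finset F))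
    (fun t => p.eval t ≠ q.eval t)
  rw [Finset.card_univ] at h1
  refine eq_of_natDegree_lt_card_of_eval_eq' p q
    (Finset.univ.filter fun t => ¬ p.eval t ≠ q.eval t) ?_ ?_
  · simp
  · have h2 : (Finset.univ.filter fun t => p.eval t ≠ q.eval t).card + k < Fintype.card F := by
      exact_mod_cast h
    have := max_le hp hq
    omega

/-- The averaged form of the Polishchuk–Spielman lemma. -/
theorem exists_bivariate_of_expect_ne_le {k : ℕ} {r c : F → F[X]}
    (hr : ∀ i, (r i).natDegree ≤ k) (hc : ∀ j, (c j).natDegree ≤ k)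
    (hk : 8 * k ≤ Fintype.card F)
    (hD : 𝔼 i, 𝔼 j, ind ((r i).eval j ≠ (c j).eval i) ≤ 1 / 32) :
    ∃ Q : F[X][Y], Q.natDegree ≤ k ∧ (swap Q).natDegree ≤ k ∧
      𝔼 i, ind (Q.map (evalRingHom i) ≠ r i) ≤
        2 * 𝔼 i, 𝔼 j, ind ((r i).eval j ≠ (c j).eval i) ∧
      𝔼 j, ind ((swap Q).map (evalRingHom j) ≠ c j) ≤
        2 * 𝔼 i, 𝔼 j, ind ((r i).eval j ≠ (c j).eval i) := by
  classical
  have hn := card_field_pos (F := F)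
  have hkR : 8 * (k : ℝ) ≤ Fintype.card F := by exact_mod_cast hk
  set n := Fintype.card F with hnF
  obtain ⟨Q, hQ1, hQ2, hQr, hQc⟩ := exists_bivariate_of_card_ne_lt (e := n / 4) hr hc (by
    have h1 := expect_prod fun i j => ind ((r i).eval j ≠ (c j).eval i)
    rw [← h1, expect_ind_eq, Fintype.card_prod, div_le_iff₀ (by positivity), ← hnF] at hD
    have h2 : (n : ℝ) < 4 * ((n / 4 : ℕ) + 1) := by
      exact_mod_cast (by omega : n < 4 * (n / 4 + 1))
    have h3 : ((Finset.univ.filter fun p : F × F =>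
        (r p.1).eval p.2 ≠ (c p.2).eval p.1).card : ℝ) < ((n / 4 : ℕ) + 1) * ((n / 4 : ℕ) + 1) := by
      refine hD.trans_lt ?_
      push_cast
      nlinarith
    exact_mod_cast h3) (by
      have : 0 < n := Fintype.card_pos
      omega)
  have hn4 : ((n / 4 : ℕ) : ℝ) ≤ n / 4 := Nat.cast_div_le
  have hQr' : 𝔼 i, ind (Q.map (evalRingHom i) ≠ r i) ≤ 1 / 4 := by
    rw [expect_ind_eq, div_le_iff₀ hn]
    have : ((Finset.univ.filter fun i => Q.map (evalRingHom i) ≠ r i).card : ℝ) ≤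
      (n / 4 : ℕ) := by exact_mod_cast hQr
    linarith
  have hQc' : 𝔼 j, ind ((swap Q).map (evalRingHom j) ≠ c j) ≤ 1 / 4 := by
    rw [expect_ind_eq, div_le_iff₀ hn]
    have : ((Finset.univ.filter fun j => (swap Q).map (evalRingHom j) ≠ c j).card : ℝ) ≤
      (n / 4 : ℕ) := by exact_mod_cast hQc
    linarith
  have hev : ∀ i j, ((swap Q).map (evalRingHom j)).eval i = (Q.map (evalRingHom i)).eval j := by
    intro i j
    rw [eval_map_eval, eval_map_eval, evalEval_swap]
  have hQi : ∀ i, (Q.map (evalRingHom i)).natDegree ≤ k := fun i => natDegree_map_le.trans hQ1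
  have hQj : ∀ j, ((swap Q).map (evalRingHom j)).natDegree ≤ k :=
    fun j => natDegree_map_le.trans hQ2
  have key : ∀ {p q : F[X]} (b : F → Prop) (g : F → Prop), p.natDegree ≤ k → q.natDegree ≤ k →
      𝔼 t, ind (b t) ≤ 1 / 4 → (∀ t, p.eval t ≠ q.eval t → b t ∨ g t) →
      ind (p ≠ q) ≤ 2 * 𝔼 t, ind (g t) := by
    intro p q b g hp hq hb hbg
    refine ind_le_of_imp (mul_nonneg two_pos.le (expect_ind_nonneg _)) fun hpq => ?_
    by_contra hlt
    refine hpq (eq_of_expect_eval_ne hp hq ?_)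
    have := expect_mono fun t => ind_le_add (hbg t)
    rw [expect_add] at this
    rw [← hnF]
    have h2 : 𝔼 t, ind (p.eval t ≠ q.eval t) < 3 / 4 := by linarith
    have h3 := mul_lt_mul_of_pos_left h2 hn
    linarith
  refine ⟨Q, hQ1, hQ2, ?_, ?_⟩
  · rw [← expect_const_mul]
    refine expect_mono fun i => ?_
    refine key (fun j => (swap Q).map (evalRingHom j) ≠ c j) _ (hQi i) (hr i) hQc' fun j hj => ?_
    by_contra! hcon
    rw [hcon.2, ← hcon.1, hev] at hj
    exact hj rfl
  · rw [expect_swap, ← expect_const_mul]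
    refine expect_mono fun j => ?_
    refine key (fun i => Q.map (evalRingHom i) ≠ r i) _ (hQj j) (hc j) hQr' fun i hi => ?_
    by_contra! hcon
    rw [← hcon.2, ← hcon.1, hev] at hi
    exact hi rfl

end Agreement

section BestFit

open Polynomial
open scoped BigOperators

variable {F V : Type*} [Field F] [Fintype F] [AddCommGroup V] [Module F V]

/-- `C` restricts, on each line with direction `h`, to a polynomial of degree at most `k` which is
as close to `f` on that line as possible. -/
structure IsBestFit (k : ℕ) (f : V → F) (C : V → V → F) : Prop where
  exists_poly : ∀ x h, ∃ p : F[X], p.natDegree ≤ k ∧ ∀ t : F, C (x + t • h) h = p.eval t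
  le_of_natDegree_le : ∀ x h (p : F[X]), p.natDegree ≤ k →
    𝔼 t : F, ind (C (x + t • h) h ≠ f (x + t • h)) ≤ 𝔼 t, ind (p.eval t ≠ f (x + t • h))

theorem exists_closest_poly (k : ℕ) (f : F → F) : ∃ p : F[X], p.natDegree ≤ k ∧
    ∀ q : F[X], q.natDegree ≤ k → 𝔼 t, ind (p.eval t ≠ f t) ≤ 𝔼 t, ind (q.eval t ≠ f t) := by
  classical
  let N : F[X] → ℕ := fun p => (Finset.univ.filter fun t => p.eval t ≠ f t).card
  obtain ⟨p, hp, hmin⟩ := (measure N).wf.has_min {p | p.natDegree ≤ k} ⟨0, by simp⟩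
  refine ⟨p, hp, fun q hq => ?_⟩
  rw [expect_ind_eq, expect_ind_eq]
  have : N p ≤ N q := not_lt.1 (hmin q hq)
  gcongr

theorem exists_isBestFit (k : ℕ) (f : V → F) : ∃ C, IsBestFit k f C := by
  classical
  choose p hp hmin using fun x h : V => exists_closest_poly k (fun t : F => f (x + t • h))
  let base : V → V → V := fun x h => ((Submodule.Quotient.mk x : V ⧸ F ∙ h)).out
  have hbase : ∀ x h : V, ∃ s : F, s • h = x - base x h := by
    intro x h
    rw [← Submodule.mem_span_singleton, ← Submodule.Quotient.eq]
    exact (Quotient.out_eq _).symm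
  have hbase' : ∀ (x h : V) (t : F), base (x + t • h) h = base x h := by
    intro x h t
    have : (Submodule.Quotient.mk (x + t • h) : V ⧸ F ∙ h) = Submodule.Quotient.mk x := by
      rw [Submodule.Quotient.eq, add_sub_cancel_left, Submodule.mem_span_singleton]
      exact ⟨t, rfl⟩
    simp only [base, this]
  choose s hs using hbase
  have hs' : ∀ (x h : V) (t : F), h ≠ 0 → s (x + t • h) h = s x h + t := by
    intro x h t hh
    refine smul_left_injective F hh ?_
    simp only [add_smul, hs, hbase']
    abel
  let C : V → V → F := fun x h => if h = 0 then f x else (p (base x h) h).eval (s x h)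
  have hC : ∀ x h (t : F), h ≠ 0 → C (x + t • h) h = (p (base x h) h).eval (s x h + t) := by
    intro x h t hh
    simp only [C, if_neg hh, hs' x h t hh, hbase']
  have hx : ∀ x h : V, x = base x h + s x h • h := by
    intro x h; rw [hs]; abel
  refine ⟨C, fun x h => ?_, fun x h q hq => ?_⟩
  · by_cases hh : h = 0
    · refine ⟨Polynomial.C (f x), by simp, fun t => ?_⟩
      simp [C, hh]
    · refine ⟨(p (base x h) h).comp (X + Polynomial.C (s x h)), ?_, fun t => ?_⟩
      · rw [natDegree_comp, natDegree_X_add_C, mul_one]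
        exact hp _ _
      · rw [hC x h t hh, eval_comp]
        simp [add_comm]
  · by_cases hh : h = 0
    · refine le_trans (le_of_eq ?_) (expect_ind_nonneg _)
      simp [C, hh, ind_neg]
    · have h1 := hmin (base x h) h (q.comp (X - Polynomial.C (s x h))) (by
        rw [natDegree_comp, natDegree_X_sub_C, mul_one]
        exact hq)
      rw [← expect_const_add (s x h),
        ← expect_const_add (s x h) (fun t => ind (eval t (q.comp _) ≠ _))] at h1
      have h2 : ∀ t : F, base x h + (s x h + t) • h = x + t • h := by
        intro t
        rw [add_smul, ← add_assoc, ← hx]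
      simpa only [h2, eval_comp, eval_sub, eval_X, eval_C, add_sub_cancel_left, ← hC x h _ hh]
        using h1

variable {k : ℕ} {f : V → F} {C : V → V → F}

/-- The fraction of points of the line through `x` with direction `h` where `C · h` and `f`
differ. -/
noncomputable def lineErr (f : V → F) (C : V → V → F) (x h : V) : ℝ :=
  𝔼 t : F, ind (C (x + t • h) h ≠ f (x + t • h))

theorem lineErr_nonneg (x h : V) : 0 ≤ lineErr f C x h := expect_ind_nonneg _

theorem lineErr_le_one (x h : V) : lineErr f C x h ≤ 1 := expect_ind_le_one _

theorem lineErr_add_smul (x h : V) (s : F) : lineErr f C (x + s • h) h = lineErr f C x h := by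
  rw [lineErr, lineErr, ← expect_const_add s (fun t => ind (C (x + t • h) h ≠ f (x + t • h)))]
  simp only [add_smul, add_assoc]

theorem IsBestFit.eq_eval (hC : IsBestFit k f C) (x h : V) (q : F[X]) (hq : q.natDegree ≤ k)
    (h2 : Fintype.card F * (2 * 𝔼 t, ind (q.eval t ≠ f (x + t • h))) + k < Fintype.card F) (t : F) :
    C (x + t • h) h = q.eval t := by
  obtain ⟨p, hp, hCp⟩ := hC.exists_poly x h
  have h1 := hC.le_of_natDegree_le x h q hq
  simp only [hCp] at h1 ⊢
  congr 1
  refine eq_of_expect_eval_ne hp hq (lt_of_le_of_lt ?_ h2)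
  have : 𝔼 t, ind (p.eval t ≠ q.eval t) ≤ 𝔼 t, ind (p.eval t ≠ f (x + t • h)) +
      𝔼 t, ind (q.eval t ≠ f (x + t • h)) := by
    rw [← expect_add]
    refine expect_mono fun t => ind_le_add fun hne => ?_
    by_contra! hcon
    exact hne (hcon.1.trans hcon.2.symm)
  have := card_field_pos (F := F)
  gcongr
  linarith

variable [Fintype V]

theorem expect_lineErr : 𝔼 x, 𝔼 h, lineErr f C x h = 𝔼 x, 𝔼 h, ind (C x h ≠ f x) := by
  rw [expect_swap, expect_swap (fun x h => ind (C x h ≠ f x))]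
  refine Finset.expect_congr rfl fun h _ => ?_
  simp only [lineErr]
  rw [expect_swap]
  simp only [fun t : F => expect_add_const (t • h) (fun x => ind (C x h ≠ f x))]
  exact Fintype.expect_const _

end BestFit

section LocalConsistency

open Polynomial Polynomial.Bivariate
open scoped BigOperators

variable {F V : Type*} [Field F] [AddCommGroup V] [Module F V] {k : ℕ}
  {f g : V → F} {C : V → V → F}

theorem expect_swap_pairs {ι κ μ ν : Type*} [Fintype ι] [Fintype κ] [Fintype μ] [Fintype ν]
    (φ : ι → κ → μ → ν → ℝ) :
    𝔼 a, 𝔼 b, 𝔼 c, 𝔼 d, φ a b c d = 𝔼 c, 𝔼 d, 𝔼 a, 𝔼 b, φ a b c d := by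
  have h1 : ∀ a, 𝔼 b, 𝔼 c, 𝔼 d, φ a b c d = 𝔼 c, 𝔼 d, 𝔼 b, φ a b c d := by
    intro a
    rw [expect_swap]
    refine Finset.expect_congr rfl fun c _ => ?_
    rw [expect_swap]
  simp_rw [h1]
  rw [expect_swap]
  refine Finset.expect_congr rfl fun c _ => ?_
  rw [expect_swap]

theorem expect_add_smul_le [Fintype V] {φ : V → ℝ} (h0 : ∀ x, 0 ≤ φ x) (h1 : ∀ x, φ x ≤ 1) (a : V)
    (t : F) : 𝔼 h, φ (a + t • h) ≤ 𝔼 x, φ x + ind (t = 0) := by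
  by_cases ht : t = 0
  · rw [ind_pos ht]
    have h2 : 𝔼 h, φ (a + t • h) ≤ 1 := expect_le_const fun h => h1 _
    have h3 : 0 ≤ 𝔼 x, φ x := expect_nonneg' h0
    linarith
  · rw [expect_add_smul a ht, ind_neg ht, add_zero]

theorem expect_ind_add_smul_le [Fintype V] (p : V → Prop) (a : V) (t : F) :
    𝔼 h, ind (p (a + t • h)) ≤ 𝔼 x, ind (p x) + ind (t = 0) :=
  expect_add_smul_le (fun _ => ind_nonneg _) (fun _ => ind_le_one _) a t

theorem ind_ne_le_add {α : Type*} (a b c : α) : ind (a ≠ b) ≤ ind (a ≠ c) + ind (b ≠ c) :=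
  ind_le_add fun hne => by
    by_contra! hcon
    exact hne (hcon.1.trans hcon.2.symm)

variable [Fintype F]

theorem IsBestFit.row_eq (hC : IsBestFit k f C) (hk : 8 * k ≤ Fintype.card F) (x h h' : V)
    {Q : F[X][Y]} {c : F → F[X]} (hc : ∀ i j : F, C (x + i • h' + j • h) h' = (c j).eval i)
    (hQ : Q.natDegree ≤ k) (hQc : 𝔼 j, ind ((swap Q).map (evalRingHom j) ≠ c j) ≤ 1 / 16)
    (hA : 𝔼 j : F, ind (f (x + j • h) ≠ C (x + j • h) h') ≤ 1 / 8) (j : F) :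
    C (x + j • h) h = Q.evalEval 0 j := by
  have hn := card_field_pos (F := F)
  have hkR : 8 * (k : ℝ) ≤ Fintype.card F := by exact_mod_cast hk
  rw [← eval_map_eval]
  refine hC.eq_eval x h _ (natDegree_map_le.trans hQ) ?_ j
  have h1 : 𝔼 t, ind ((Q.map (evalRingHom 0)).eval t ≠ f (x + t • h)) ≤ 1 / 16 + 1 / 8 := by
    refine le_trans ?_ (add_le_add hQc hA)
    rw [← expect_add]
    refine expect_mono fun t => ind_le_add fun hne => ?_
    by_contra! hcon
    apply hne
    have := hc 0 t
    rw [zero_smul, add_zero] at this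
    rw [hcon.2, this, ← hcon.1, eval_map_eval, eval_map_eval, evalEval_swap]
  have := mul_le_mul_of_nonneg_left h1 hn.le
  linarith

/-- Two best fits through a point agree, up to the disagreements on the plane they span. -/
theorem IsBestFit.ind_ne_le (hC : IsBestFit k f C) (hk : 8 * k ≤ Fintype.card F) (x h₁ h₂ : V) :
    ind (C x h₁ ≠ C x h₂) ≤
        32 * (𝔼 i : F, 𝔼 j : F, ind (C (x + i • h₁ + j • h₂) h₂ ≠ C (x + i • h₁ + j • h₂) h₁)) +
        8 * (𝔼 j : F, ind (f (x + j • h₂) ≠ C (x + j • h₂) h₁)) +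
        8 * (𝔼 i : F, ind (f (x + i • h₁) ≠ C (x + i • h₁) h₂)) ∧
      𝔼 j : F, ind (C (x + j • h₂) h₂ ≠ f (x + j • h₂)) ≤
        32 * (𝔼 i : F, 𝔼 j : F, ind (C (x + i • h₁ + j • h₂) h₂ ≠ C (x + i • h₁ + j • h₂) h₁)) +
        8 * (𝔼 j : F, ind (f (x + j • h₂) ≠ C (x + j • h₂) h₁)) := by
  choose r hr hrC using fun i : F => hC.exists_poly (x + i • h₁) h₂
  choose c hc hcC using fun j : F => hC.exists_poly (x + j • h₂) h₁
  have hcC' : ∀ i j : F, C (x + i • h₁ + j • h₂) h₁ = (c j).eval i := by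
    intro i j
    rw [← hcC]
    congr 1
    abel
  set D := 𝔼 i : F, 𝔼 j : F, ind (C (x + i • h₁ + j • h₂) h₂ ≠ C (x + i • h₁ + j • h₂) h₁) with hD
  set A := 𝔼 j : F, ind (f (x + j • h₂) ≠ C (x + j • h₂) h₁) with hA
  set A' := 𝔼 i : F, ind (f (x + i • h₁) ≠ C (x + i • h₁) h₂)
  have hD0 : 0 ≤ D := expect_nonneg' fun i => expect_ind_nonneg _
  have hA0 : 0 ≤ A := expect_ind_nonneg _
  have hA'0 : 0 ≤ A' := expect_ind_nonneg _
  by_cases hD1 : D ≤ 1 / 32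
  swap
  · refine ⟨(ind_le_one _).trans (by linarith), (expect_ind_le_one _).trans (by linarith)⟩
  by_cases hA1 : A ≤ 1 / 8
  swap
  · refine ⟨(ind_le_one _).trans (by linarith), (expect_ind_le_one _).trans (by linarith)⟩
  simp only [hrC, hcC'] at hD
  obtain ⟨Q, hQ1, hQ2, hQr, hQc⟩ := exists_bivariate_of_expect_ne_le hr hc hk
    (by rw [← hD]; exact hD1)
  rw [← hD] at hQr hQc
  have hrow := hC.row_eq hk x h₂ h₁ hcC' hQ1 (by linarith) hA1
  constructor
  · refine ind_le_of_imp (by linarith) fun hne => ?_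
    by_contra hlt
    refine hne ?_
    have hcol := hC.row_eq (Q := swap Q) (c := r) hk x h₁ h₂ (fun i j => by
      rw [← hrC]
      congr 1
      abel) hQ2 (by
      rw [swap_swap_apply]
      linarith) (by linarith)
    have h1 := hrow 0
    have h2 := hcol 0
    rw [evalEval_swap] at h2
    rw [zero_smul, add_zero] at h1 h2
    rw [h1, h2]
  · calc _ ≤ 2 * D + A := ?_
      _ ≤ _ := by linarith
    refine le_trans ?_ (add_le_add_left hQc _)
    rw [hA, ← expect_add]
    refine expect_mono fun j => ind_le_add fun hne => ?_
    by_contra! hcon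
    apply hne
    have := hcC' 0 j
    rw [zero_smul, add_zero] at this
    rw [hrow, hcon.2, this, ← hcon.1, eval_map_eval, evalEval_swap]

variable [Fintype V] {η : ℝ}

theorem expect_disagreement_le (hη : 𝔼 x, 𝔼 h, ind (C x h ≠ f x) ≤ η) (x : V) :
    𝔼 h₁, 𝔼 h₂, 𝔼 i : F, 𝔼 j : F,
      ind (C (x + i • h₁ + j • h₂) h₂ ≠ C (x + i • h₁ + j • h₂) h₁) ≤
      2 * (η + (Fintype.card F : ℝ)⁻¹) := by
  rw [expect_swap_pairs]
  have key : ∀ i j : F, 𝔼 h₁, 𝔼 h₂,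
      ind (C (x + i • h₁ + j • h₂) h₂ ≠ C (x + i • h₁ + j • h₂) h₁) ≤
      (η + ind (i = 0)) + (η + ind (j = 0)) := by
    intro i j
    refine (expect_mono fun h₁ => expect_mono fun h₂ =>
      ind_ne_le_add _ _ (f (x + i • h₁ + j • h₂))).trans ?_
    simp_rw [expect_add]
    refine add_le_add ?_ ?_
    · rw [expect_swap] at hη ⊢
      calc _ ≤ 𝔼 h₂, (𝔼 x, ind (C x h₂ ≠ f x) + ind (i = 0)) := by
            refine expect_mono fun h₂ => ?_
            simp only [add_right_comm x _ (j • h₂)]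
            exact expect_ind_add_smul_le (fun z => C z h₂ ≠ f z) _ _
        _ ≤ _ := by
            rw [expect_add, Fintype.expect_const]
            linarith
    · rw [expect_swap] at hη
      calc _ ≤ 𝔼 h₁, (𝔼 x, ind (C x h₁ ≠ f x) + ind (j = 0)) :=
            expect_mono fun h₁ => expect_ind_add_smul_le (fun z => C z h₁ ≠ f z) _ _
        _ ≤ _ := by
            rw [expect_add, Fintype.expect_const]
            linarith
  refine (expect_mono fun i => expect_mono fun j => key i j).trans (le_of_eq ?_)
  simp_rw [expect_add, expect_ind_eq_const, Fintype.expect_const, expect_ind_eq_const]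
  ring

theorem expect_line_ne_le (hη : 𝔼 x, 𝔼 h, ind (C x h ≠ f x) ≤ η) (x : V) :
    𝔼 h₁, 𝔼 h₂, 𝔼 j : F, ind (f (x + j • h₂) ≠ C (x + j • h₂) h₁) ≤
      η + (Fintype.card F : ℝ)⁻¹ := by
  rw [expect_swap] at hη
  have h1 : ∀ h₁, 𝔼 h₂, 𝔼 j : F, ind (f (x + j • h₂) ≠ C (x + j • h₂) h₁) ≤
      𝔼 x, ind (C x h₁ ≠ f x) + (Fintype.card F : ℝ)⁻¹ := by
    intro h₁
    rw [expect_swap]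
    calc _ ≤ 𝔼 j : F, (𝔼 x, ind (C x h₁ ≠ f x) + ind (j = 0)) := by
          refine expect_mono fun j => ?_
          simp only [ne_comm (a := f _)]
          exact expect_ind_add_smul_le (fun z => C z h₁ ≠ f z) _ _
      _ = _ := by rw [expect_add, Fintype.expect_const, expect_ind_eq_const]
  refine (expect_mono h1).trans ?_
  rw [expect_add, Fintype.expect_const]
  linarith

theorem IsBestFit.expect_ind_ne_le (hC : IsBestFit k f C) (hk : 8 * k ≤ Fintype.card F)
    (hη : 𝔼 x, 𝔼 h, ind (C x h ≠ f x) ≤ η) (x : V) :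
    𝔼 h₁, 𝔼 h₂, ind (C x h₁ ≠ C x h₂) ≤ 80 * (η + (Fintype.card F : ℝ)⁻¹) ∧
      𝔼 h, 𝔼 j : F, ind (C (x + j • h) h ≠ f (x + j • h)) ≤
        80 * (η + (Fintype.card F : ℝ)⁻¹) := by
  have hD := expect_disagreement_le hη x
  have hA := expect_line_ne_le hη x
  have hη0 : 0 ≤ η := le_trans (expect_nonneg' fun _ => expect_ind_nonneg _) hη
  have hn := card_field_pos (F := F)
  have hn' : 0 ≤ (Fintype.card F : ℝ)⁻¹ := by positivity
  constructor
  · have h1 := expect_mono fun h₁ => expect_mono fun h₂ => (hC.ind_ne_le hk x h₁ h₂).1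
    simp_rw [expect_add, expect_const_mul] at h1
    rw [expect_swap (fun h₁ h₂ : V => 𝔼 i : F, ind (f (x + i • h₁) ≠ C (x + i • h₁) h₂))] at h1
    linarith
  · have h1 := expect_mono fun h₁ => expect_mono fun h₂ => (hC.ind_ne_le hk x h₁ h₂).2
    simp_rw [expect_add, expect_const_mul] at h1
    rw [Fintype.expect_const] at h1
    linarith

theorem IsBestFit.exists_consensus (hC : IsBestFit k f C) (hk : 8 * k ≤ Fintype.card F)
    (hη : 𝔼 x, 𝔼 h, ind (C x h ≠ f x) ≤ η) :
    ∃ g : V → F, ∀ x, 𝔼 h, ind (C x h ≠ g x) ≤ 80 * (η + (Fintype.card F : ℝ)⁻¹) := by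
  have h1 : ∀ x, ∃ h', 𝔼 h, ind (C x h ≠ C x h') ≤ 80 * (η + (Fintype.card F : ℝ)⁻¹) := by
    intro x
    obtain ⟨h', hh'⟩ := exists_le_expect fun h' => 𝔼 h, ind (C x h ≠ C x h')
    refine ⟨h', hh'.trans ?_⟩
    rw [expect_swap]
    exact (hC.expect_ind_ne_le hk hη x).1
  choose w hw using h1
  exact ⟨fun x => C x (w x), hw⟩

end LocalConsistency

section LinePoly

open Polynomial Polynomial.Bivariate
open scoped BigOperators

variable {F V : Type*} [Field F] [Fintype F] [AddCommGroup V] [Module F V] {k : ℕ}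
  {f g : V → F} {C : V → V → F}

theorem exists_poly_near_line (hC : ∀ x h, ∃ p : F[X], p.natDegree ≤ k ∧
      ∀ t : F, C (x + t • h) h = p.eval t) (hk : 8 * k ≤ Fintype.card F) (g : V → F)
    (x h h₁ h₂ : V) (i₀ : F) :
    ind (¬ ∃ p : F[X], p.natDegree ≤ k ∧ p.eval i₀ = g (x + i₀ • h) ∧
        𝔼 i, ind (p.eval i ≠ g (x + i • h)) ≤ 1 / 4) ≤
      32 * (𝔼 i : F, 𝔼 j : F, ind (C (x + i • h + j • (h₁ + i • h₂)) (h₁ + i • h₂) ≠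
        C (x + i • h + j • (h₁ + i • h₂)) (h + j • h₂))) +
      4 * (𝔼 j : F, ind (C (x + i₀ • h + j • (h₁ + i₀ • h₂)) (h₁ + i₀ • h₂) ≠
        C (x + i₀ • h + j • (h₁ + i₀ • h₂)) (h + j • h₂))) +
      ind (C (x + i₀ • h) (h₁ + i₀ • h₂) ≠ g (x + i₀ • h)) +
      8 * 𝔼 i : F, ind (C (x + i • h) (h₁ + i • h₂) ≠ g (x + i • h)) := by
  choose r hr hrC using fun i : F => hC (x + i • h) (h₁ + i • h₂)
  choose c hc hcC using fun j : F => hC (x + j • h₁) (h + j • h₂)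
  have hcC' : ∀ i j : F, C (x + i • h + j • (h₁ + i • h₂)) (h + j • h₂) = (c j).eval i := by
    intro i j
    rw [← hcC]
    congr 1
    module
  have hr0 : ∀ i, C (x + i • h) (h₁ + i • h₂) = (r i).eval 0 := by
    intro i
    rw [← hrC, zero_smul, add_zero]
  simp only [hrC, hcC', hr0]
  set D := 𝔼 i : F, 𝔼 j : F, ind ((r i).eval j ≠ (c j).eval i)
  set A := 𝔼 j : F, ind ((r i₀).eval j ≠ (c j).eval i₀) with hA
  set B₀ := ind ((r i₀).eval 0 ≠ g (x + i₀ • h)) with hB₀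
  set B := 𝔼 i : F, ind ((r i).eval 0 ≠ g (x + i • h)) with hB
  have hD0 : 0 ≤ D := expect_nonneg' fun i => expect_ind_nonneg _
  have hA0 : 0 ≤ A := expect_ind_nonneg _
  have hB₀0 : 0 ≤ B₀ := ind_nonneg _
  have hB0 : 0 ≤ B := expect_ind_nonneg _
  refine ind_le_of_imp (by positivity) fun hne => ?_
  by_contra! hlt
  apply hne
  obtain ⟨Q, hQ1, hQ2, hQr, hQc⟩ := exists_bivariate_of_expect_ne_le hr hc hk (by linarith)
  change _ ≤ 2 * D at hQr hQc
  have hn := card_field_pos (F := F)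
  have hkR : 8 * (k : ℝ) ≤ Fintype.card F := by exact_mod_cast hk
  have heval : ∀ i, ((swap Q).map (evalRingHom 0)).eval i = (Q.map (evalRingHom i)).eval 0 := by
    intro i
    rw [eval_map_eval, eval_map_eval, evalEval_swap]
  refine ⟨(swap Q).map (evalRingHom 0), natDegree_map_le.trans hQ2, ?_, ?_⟩
  · have h0 : (r i₀).eval 0 = g (x + i₀ • h) := by
      by_contra hne
      linarith [ind_pos hne]
    have hrow : r i₀ = Q.map (evalRingHom i₀) := by
      refine eq_of_expect_eval_ne (hr _) (natDegree_map_le.trans hQ1) ?_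
      have h1 : 𝔼 j, ind ((r i₀).eval j ≠ (Q.map (evalRingHom i₀)).eval j) ≤ A + 2 * D := by
        refine le_trans ?_ (add_le_add_right hQc _)
        rw [hA, ← expect_add]
        refine expect_mono fun j => ind_le_add fun hne => ?_
        by_contra! hcon
        apply hne
        rw [hcon.1, ← hcon.2, eval_map_eval, eval_map_eval, evalEval_swap]
      have h2 := mul_le_mul_of_nonneg_left (h1.trans (by linarith : _ ≤ (1 : ℝ) / 2)) hn.le
      linarith
    rw [heval, ← hrow, h0]
  · have h1 : 𝔼 i, ind (((swap Q).map (evalRingHom 0)).eval i ≠ g (x + i • h)) ≤ 2 * D + B := by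
      refine le_trans ?_ (add_le_add_left hQr _)
      rw [hB, ← expect_add]
      refine expect_mono fun i => ind_le_add fun hne => ?_
      by_contra! hcon
      apply hne
      rw [heval, hcon.1, hcon.2]
    linarith

variable [Fintype V] {η : ℝ}

theorem IsBestFit.expect_ne_twisted_le (hC : IsBestFit k f C) (hk : 8 * k ≤ Fintype.card F)
    (hη : 𝔼 x, 𝔼 h, ind (C x h ≠ f x) ≤ η) (y h : V) (i : F) :
    𝔼 h₁, 𝔼 h₂, 𝔼 j : F, ind (C (y + j • (h₁ + i • h₂)) (h₁ + i • h₂) ≠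
        C (y + j • (h₁ + i • h₂)) (h + j • h₂)) ≤ 82 * (η + (Fintype.card F : ℝ)⁻¹) := by
  have hη0 : 0 ≤ η := le_trans (expect_nonneg' fun _ => expect_ind_nonneg _) hη
  rw [expect_swap]
  have h1 : ∀ h₂, 𝔼 h₁, 𝔼 j : F, ind (C (y + j • (h₁ + i • h₂)) (h₁ + i • h₂) ≠
        C (y + j • (h₁ + i • h₂)) (h + j • h₂)) ≤
      80 * (η + (Fintype.card F : ℝ)⁻¹) +
        𝔼 j : F, 𝔼 w, ind (C (y + j • w) (h + j • h₂) ≠ f (y + j • w)) := by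
    intro h₂
    rw [expect_add_const (i • h₂) fun w => 𝔼 j : F, ind (C (y + j • w) w ≠
      C (y + j • w) (h + j • h₂))]
    refine (expect_mono fun w => expect_mono fun j =>
      ind_ne_le_add _ _ (f (y + j • w))).trans ?_
    simp_rw [expect_add]
    refine add_le_add ((hC.expect_ind_ne_le hk hη y).2) ?_
    rw [expect_swap]
  refine (expect_mono h1).trans ?_
  rw [expect_add, Fintype.expect_const, expect_swap]
  have h2 : ∀ j : F, 𝔼 h₂, 𝔼 w, ind (C (y + j • w) (h + j • h₂) ≠ f (y + j • w)) ≤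
      η + 2 * ind (j = 0) := by
    intro j
    calc _ ≤ 𝔼 h₂, (𝔼 z, ind (C z (h + j • h₂) ≠ f z) + ind (j = 0)) :=
          expect_mono fun h₂ => expect_ind_add_smul_le (fun z => C z (h + j • h₂) ≠ f z) _ _
      _ = 𝔼 z, 𝔼 h₂, ind (C z (h + j • h₂) ≠ f z) + ind (j = 0) := by
          rw [expect_add, Fintype.expect_const, expect_swap]
      _ ≤ 𝔼 z, (𝔼 v, ind (C z v ≠ f z) + ind (j = 0)) + ind (j = 0) := by
          gcongr with z
          exact expect_ind_add_smul_le (fun v => C z v ≠ f z) _ _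
      _ ≤ _ := by
          rw [expect_add, Fintype.expect_const]
          linarith
  have h3 := expect_mono h2
  rw [expect_add, Fintype.expect_const, expect_const_mul, expect_ind_eq_const] at h3
  linarith

theorem IsBestFit.exists_poly_line (hC : IsBestFit k f C) (hk : 8 * k ≤ Fintype.card F)
    (hη : 𝔼 x, 𝔼 h, ind (C x h ≠ f x) ≤ η) (hη' : η + (Fintype.card F : ℝ)⁻¹ ≤ 1 / 4000)
    (hg : ∀ x, 𝔼 h, ind (C x h ≠ g x) ≤ 80 * (η + (Fintype.card F : ℝ)⁻¹)) (x h : V) :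
    ∃ p : F[X], p.natDegree ≤ k ∧ ∀ t : F, g (x + t • h) = p.eval t := by
  have hn := card_field_pos (F := F)
  have hkR : 8 * (k : ℝ) ≤ Fintype.card F := by exact_mod_cast hk
  have hB : ∀ i : F, 𝔼 h₁, 𝔼 h₂, ind (C (x + i • h) (h₁ + i • h₂) ≠ g (x + i • h)) ≤
      80 * (η + (Fintype.card F : ℝ)⁻¹) := by
    intro i
    rw [expect_swap]
    simp_rw [fun h₂ => expect_add_const (i • h₂)
      (fun w => ind (C (x + i • h) w ≠ g (x + i • h)))]
    rw [Fintype.expect_const]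
    exact hg _
  have hA := fun i : F => hC.expect_ne_twisted_le hk hη (x + i • h) h i
  have hex : ∀ i₀ : F, ∃ p : F[X], p.natDegree ≤ k ∧ p.eval i₀ = g (x + i₀ • h) ∧
        𝔼 i, ind (p.eval i ≠ g (x + i • h)) ≤ 1 / 4 := by
    intro i₀
    by_contra hne
    have h1 := expect_mono fun h₁ => expect_mono fun h₂ =>
      exists_poly_near_line hC.exists_poly hk g x h h₁ h₂ i₀
    simp_rw [expect_add, expect_const_mul] at h1
    rw [ind_pos hne, Fintype.expect_const, Fintype.expect_const] at h1
    have hsw : ∀ φ : V → V → F → ℝ, 𝔼 h₁, 𝔼 h₂, 𝔼 i, φ h₁ h₂ i = 𝔼 i, 𝔼 h₁, 𝔼 h₂, φ h₁ h₂ i := by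
      intro φ
      rw [expect_swap (fun (i : F) (h₁ : V) => 𝔼 h₂, φ h₁ h₂ i)]
      exact Finset.expect_congr rfl fun h₁ _ => expect_swap _
    have h2 : 𝔼 h₁, 𝔼 h₂, 𝔼 i : F, 𝔼 j : F, ind (C (x + i • h + j • (h₁ + i • h₂)) (h₁ + i • h₂) ≠
        C (x + i • h + j • (h₁ + i • h₂)) (h + j • h₂)) ≤
        82 * (η + (Fintype.card F : ℝ)⁻¹) := by
      rw [hsw]
      exact expect_le_const hA
    have h3 : 𝔼 h₁, 𝔼 h₂, 𝔼 i : F, ind (C (x + i • h) (h₁ + i • h₂) ≠ g (x + i • h)) ≤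
        80 * (η + (Fintype.card F : ℝ)⁻¹) := by
      rw [hsw]
      exact expect_le_const hB
    linarith [hA i₀, hB i₀]
  choose p hp hpe hpg using hex
  refine ⟨p 0, hp 0, fun t => ?_⟩
  rw [← hpe t]
  congr 1
  refine eq_of_expect_eval_ne (hp t) (hp 0) ?_
  have h1 : 𝔼 i, ind ((p t).eval i ≠ (p 0).eval i) ≤ 1 / 4 + 1 / 4 := by
    refine le_trans ?_ (add_le_add (hpg t) (hpg 0))
    rw [← expect_add]
    exact expect_mono fun i => ind_ne_le_add _ _ _
  have h2 := mul_le_mul_of_nonneg_left h1 hn.le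
  linarith

/-- If the best fits of `f` mostly agree with `f`, then `f` is close to a function which is a
polynomial on every line. -/
theorem exists_poly_on_lines (hC : IsBestFit k f C) (hk : 8 * k ≤ Fintype.card F)
    (hη : 𝔼 x, 𝔼 h, ind (C x h ≠ f x) ≤ η) (hη' : η + (Fintype.card F : ℝ)⁻¹ ≤ 1 / 4000) :
    ∃ g : V → F, 𝔼 x, ind (f x ≠ g x) ≤ 81 * (η + (Fintype.card F : ℝ)⁻¹) ∧
      ∀ x h, ∃ p : F[X], p.natDegree ≤ k ∧ ∀ t : F, g (x + t • h) = p.eval t := by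
  obtain ⟨g, hg⟩ := hC.exists_consensus hk hη
  have hn := card_field_pos (F := F)
  have hn' : 0 ≤ (Fintype.card F : ℝ)⁻¹ := by positivity
  refine ⟨g, ?_, hC.exists_poly_line hk hη hη' hg⟩
  calc 𝔼 x, ind (f x ≠ g x) = 𝔼 x, 𝔼 _h : V, ind (f x ≠ g x) := by
        simp_rw [Fintype.expect_const]
    _ ≤ 𝔼 x, 𝔼 h, (ind (C x h ≠ f x) + ind (C x h ≠ g x)) := by
        refine expect_mono fun x => expect_mono fun h => ?_
        rw [ne_comm (a := C x h) (b := f x), ne_comm (a := C x h)]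
        exact ind_ne_le_add _ _ _
    _ ≤ 81 * (η + (Fintype.card F : ℝ)⁻¹) := by
        simp_rw [expect_add]
        have := expect_le_const hg
        linarith

end LinePoly

section LineRestriction

open Polynomial
open scoped BigOperators

theorem Polynomial.natDegree_prod_le_sum_and_coeff {R ι : Type*} [CommSemiring R] (s : Finset ι)
    (p : ι → R[X]) (n : ι → ℕ) (h : ∀ i ∈ s, (p i).natDegree ≤ n i) :
    (∏ i ∈ s, p i).natDegree ≤ ∑ i ∈ s, n i ∧
      (∏ i ∈ s, p i).coeff (∑ i ∈ s, n i) = ∏ i ∈ s, (p i).coeff (n i) := by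
  classical
  induction s using Finset.induction_on with
  | empty => simp
  | insert a s ha ih =>
    obtain ⟨h1, h2⟩ := ih fun i hi => h i (Finset.mem_insert_of_mem hi)
    have h3 := h a (Finset.mem_insert_self a s)
    rw [Finset.prod_insert ha, Finset.sum_insert ha, Finset.prod_insert ha]
    exact ⟨natDegree_mul_le_of_le h3 h1, by rw [coeff_mul_add_eq_of_natDegree_le h3 h1, h2]⟩

namespace MvPolynomial

variable {F σ : Type*} [Field F]

/-- The univariate polynomial `t ↦ P (x + t • h)`. -/
noncomputable def lineRestriction (P : MvPolynomial σ F) (x h : σ → F) : F[X] :=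
  aeval (fun i => Polynomial.C (h i) * Polynomial.X + Polynomial.C (x i)) P

theorem eval_lineRestriction (P : MvPolynomial σ F) (x h : σ → F) (t : F) :
    (P.lineRestriction x h).eval t = eval (x + t • h) P := by
  rw [lineRestriction, ← Polynomial.coe_evalRingHom, aeval_def, hom_eval₂, eval, coe_eval₂Hom]
  congr 1
  · ext; simp
  · funext i; simp; ring

theorem totalDegree_le_of_homogeneousComponent_eq_zero {P : MvPolynomial σ F} {D : ℕ}
    (hP : P.totalDegree ≤ D + 1) (h : homogeneousComponent (D + 1) P = 0) :
    P.totalDegree ≤ D := by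
  classical
  refine Finset.sup_le fun d hd => ?_
  have h1 : d.degree ≤ D + 1 := (le_totalDegree hd).trans hP
  have h2 : d.degree ≠ D + 1 := by
    intro h2
    have := coeff_homogeneousComponent (D + 1) P d
    rw [h, if_pos h2] at this
    exact mem_support_iff.1 hd this.symm
  have h3 : d.degree = d.sum fun _ e => e := rfl
  lia

variable [Fintype σ]

theorem lineRestriction_eq_sum (P : MvPolynomial σ F) (x h : σ → F) :
    P.lineRestriction x h = ∑ d ∈ P.support, Polynomial.C (P.coeff d) *
      ∏ i, (Polynomial.C (h i) * Polynomial.X + Polynomial.C (x i)) ^ d i := by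
  rw [lineRestriction, aeval_def, eval₂_eq']
  rfl

theorem natDegree_prod_linear_pow (d : σ →₀ ℕ) (x h : σ → F) :
    (∏ i, (Polynomial.C (h i) * Polynomial.X + Polynomial.C (x i)) ^ d i).natDegree ≤ d.degree ∧
    (∏ i, (Polynomial.C (h i) * Polynomial.X + Polynomial.C (x i)) ^ d i).coeff d.degree =
      ∏ i, h i ^ d i := by
  have h1 : ∀ i, (Polynomial.C (h i) * Polynomial.X + Polynomial.C (x i)).natDegree ≤ 1 :=
    fun i => natDegree_linear_le
  have := Polynomial.natDegree_prod_le_sum_and_coeff Finset.univ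
    (fun i => (Polynomial.C (h i) * Polynomial.X + Polynomial.C (x i)) ^ d i) d
    (fun i _ => by simpa using natDegree_pow_le_of_le (d i) (h1 i))
  rw [Finsupp.degree_eq_sum]
  refine ⟨this.1, this.2.trans (Finset.prod_congr rfl fun i _ => ?_)⟩
  have := coeff_pow_of_natDegree_le (m := d i) (h1 i)
  rw [mul_one] at this
  rw [this]
  simp

theorem natDegree_lineRestriction_le (P : MvPolynomial σ F) (x h : σ → F) :
    (P.lineRestriction x h).natDegree ≤ P.totalDegree := by
  rw [lineRestriction_eq_sum]
  refine natDegree_sum_le_of_forall_le _ _ fun d hd => ?_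
  refine (natDegree_C_mul_le _ _).trans ((natDegree_prod_linear_pow d x h).1.trans ?_)
  exact le_totalDegree hd

theorem coeff_lineRestriction {P : MvPolynomial σ F} {D : ℕ} (hP : P.totalDegree ≤ D)
    (x h : σ → F) :
    (P.lineRestriction x h).coeff D = eval h (homogeneousComponent D P) := by
  classical
  rw [lineRestriction_eq_sum, homogeneousComponent_apply, map_sum, finsetSum_coeff,
    Finset.sum_filter]
  refine Finset.sum_congr rfl fun d hd => ?_
  rw [Polynomial.coeff_C_mul]
  split_ifs with hdD
  · rw [← hdD, (natDegree_prod_linear_pow d x h).2, eval_monomial, Finsupp.prod_fintype]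
    simp
  · rw [coeff_eq_zero_of_natDegree_lt, mul_zero]
    refine (natDegree_prod_linear_pow d x h).1.trans_lt (lt_of_le_of_ne ?_ hdD)
    exact (le_totalDegree hd).trans hP

end MvPolynomial

end LineRestriction

section LowDegreeOnLines

namespace MvPolynomial

variable {F σ : Type*} [Field F]

theorem eval_aeval_X (x : σ → F) (i : σ) (q : Polynomial F) :
    eval x (Polynomial.aeval (X i) q) = q.eval (x i) := by
  rw [Polynomial.aeval_def, Polynomial.hom_eval₂, Polynomial.eval, eval_X]
  congr 1
  ext; simp

theorem totalDegree_aeval_X_le (i : σ) (q : Polynomial F) :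
    (Polynomial.aeval (X i : MvPolynomial σ F) q).totalDegree ≤ q.natDegree := by
  rw [Polynomial.aeval_eq_sum_range]
  refine totalDegree_finsetSum_le fun j hj => (totalDegree_smul_le _ _).trans ?_
  rw [totalDegree_X_pow]
  exact Nat.lt_succ_iff.1 (Finset.mem_range.1 hj)

end MvPolynomial

open Polynomial
open scoped BigOperators

variable {F : Type*} [Field F] [Fintype F] {m k : ℕ}

theorem MvPolynomial.card_mul_expect_ind_eval_eq_zero_le {P : MvPolynomial (Fin m) F}
    (hP : P ≠ 0) : Fintype.card F * 𝔼 x, ind (MvPolynomial.eval x P = 0) ≤ P.totalDegree := by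
  classical
  have h := MvPolynomial.schwartz_zippel_totalDegree hP (Finset.univ : Finset F)
  rw [Fintype.piFinset_univ] at h
  have hreal : ((Finset.univ.filter fun x => MvPolynomial.eval x P = 0).card : ℝ) /
      (Fintype.card F : ℝ) ^ m ≤ P.totalDegree / Fintype.card F := by
    have := (NNRat.cast_le (K := ℝ)).2 h
    push_cast at this
    simpa using this
  rw [expect_ind_eq, Fintype.card_fun, Fintype.card_fin, ← le_div_iff₀' card_field_pos]
  exact_mod_cast hreal

/-- A polynomial whose restriction to at least half of all directions has low degree. -/
theorem totalDegree_le_of_expect_lines {P : MvPolynomial (Fin m) F} {D : ℕ}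
    (hP : P.totalDegree ≤ D) (hD : 2 * D < Fintype.card F)
    (h : 1 / 2 ≤ 𝔼 h : Fin m → F, ind (∃ x, ∃ p : F[X], p.natDegree ≤ k ∧
      ∀ t, MvPolynomial.eval (x + t • h) P = p.eval t)) : P.totalDegree ≤ k := by
  induction D with
  | zero => lia
  | succ D ih =>
    by_cases hk : D + 1 ≤ k
    · exact hP.trans hk
    refine ih (MvPolynomial.totalDegree_le_of_homogeneousComponent_eq_zero hP ?_) (by lia)
    by_contra hne
    have h1 := MvPolynomial.card_mul_expect_ind_eval_eq_zero_le hne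
    have h2 : ((MvPolynomial.homogeneousComponent (D + 1) P).totalDegree : ℝ) ≤ (D + 1 : ℕ) := by
      exact_mod_cast (MvPolynomial.homogeneousComponent_isHomogeneous (D + 1) P).totalDegree_le
    have h3 := h.trans (expect_mono (g := fun h => ind (MvPolynomial.eval h
      (MvPolynomial.homogeneousComponent (D + 1) P) = 0)) fun h => ind_mono ?_)
    · have h4 : (2 * (D + 1 : ℕ) : ℝ) < Fintype.card F := by exact_mod_cast hD
      nlinarith
    · rintro ⟨x, p, hp, hpe⟩
      rw [← MvPolynomial.coeff_lineRestriction hP x h]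
      have : P.lineRestriction x h = p := by
        have h0 : ∀ t : F, ind ((P.lineRestriction x h).eval t ≠ p.eval t) = 0 := fun t =>
          ind_neg (by rw [MvPolynomial.eval_lineRestriction, hpe]; simp)
        refine eq_of_expect_eval_ne (k := D + 1)
          ((P.natDegree_lineRestriction_le x h).trans hP) (by lia) ?_
        simp_rw [h0, Finset.expect_const_zero, mul_zero, zero_add]
        exact_mod_cast (by lia : D + 1 < Fintype.card F)
      rw [this]
      exact coeff_eq_zero_of_natDegree_lt (by lia)

theorem exists_mvPolynomial_of_lines (hk : 4 * k < Fintype.card F) (g : (Fin m → F) → F)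
    (hg : ∀ x h, ∃ p : F[X], p.natDegree ≤ k ∧ ∀ t : F, g (x + t • h) = p.eval t) :
    ∃ P : MvPolynomial (Fin m) F, P.totalDegree ≤ k ∧ ∀ x, MvPolynomial.eval x P = g x := by
  classical
  induction m with
  | zero =>
    exact ⟨MvPolynomial.C (g 0), by simp, fun x => by simp [Subsingleton.elim x 0]⟩
  | succ m ih =>
    have h1 : ∀ a : F, ∃ P : MvPolynomial (Fin m) F, P.totalDegree ≤ k ∧
        ∀ x, MvPolynomial.eval x P = g (Fin.cons a x) := by
      intro a
      refine ih _ fun x h => ?_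
      obtain ⟨p, hp, hpe⟩ := hg (Fin.cons a x) (Fin.cons 0 h)
      refine ⟨p, hp, fun t => ?_⟩
      rw [← hpe]
      congr 1
      funext i
      refine Fin.cases ?_ (fun i => ?_) i <;> simp
    choose P hP hPe using h1
    obtain ⟨I, -, hI⟩ := Finset.exists_subset_card_eq (s := (Finset.univ : Finset F)) (n := k + 1)
      (by rw [Finset.card_univ]; lia)
    let G : MvPolynomial (Fin (m + 1)) F := ∑ a ∈ I,
      Polynomial.aeval (MvPolynomial.X 0) (Lagrange.basis I id a) *
        MvPolynomial.rename Fin.succ (P a)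
    have hGe : ∀ x, MvPolynomial.eval x G = g x := by
      intro x
      obtain ⟨p, hp, hpe⟩ := hg (Fin.cons 0 (Fin.tail x)) (Fin.cons 1 0)
      have hpe' : ∀ t, g (Fin.cons t (Fin.tail x)) = p.eval t := by
        intro t
        rw [← hpe]
        congr 1
        funext i
        refine Fin.cases ?_ (fun i => ?_) i <;> simp
      have hint := Lagrange.eq_interpolate (s := I) (v := id) (f := p)
        Function.injective_id.injOn ?_
      · conv_rhs => rw [← Fin.cons_self_tail x, hpe', hint]
        rw [Lagrange.interpolate_apply, eval_finsetSum, map_sum]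
        refine Finset.sum_congr rfl fun a _ => ?_
        rw [map_mul, MvPolynomial.eval_rename, eval_mul, eval_C, mul_comm]
        congr 1
        · rw [show x ∘ Fin.succ = Fin.tail x from rfl, hPe, hpe', id]
        · rw [MvPolynomial.eval_aeval_X]
      · rw [hI]
        exact (natDegree_le_iff_degree_le.1 hp).trans_lt (by exact_mod_cast Nat.lt_succ_self k)
    have hG : G.totalDegree ≤ 2 * k := by
      refine MvPolynomial.totalDegree_finsetSum_le fun a ha => ?_
      refine (MvPolynomial.totalDegree_mul _ _).trans ?_
      have h2 := (MvPolynomial.totalDegree_rename_le Fin.succ (P a)).trans (hP a)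
      have h3 := MvPolynomial.totalDegree_aeval_X_le (0 : Fin (m + 1)) (Lagrange.basis I id a)
      have h4 := Lagrange.degree_basis (s := I) (v := id) Function.injective_id.injOn ha
      have h5 := natDegree_eq_of_degree_eq_some h4
      lia
    refine ⟨G, totalDegree_le_of_expect_lines hG (by lia) ?_, hGe⟩
    have : ∀ h : Fin (m + 1) → F, ind (∃ x, ∃ p : F[X], p.natDegree ≤ k ∧
        ∀ t, MvPolynomial.eval (x + t • h) G = p.eval t) = 1 := by
      intro h
      refine ind_pos ⟨0, ?_⟩
      simp_rw [hGe]
      exact hg 0 h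
    simp_rw [this]
    rw [Fintype.expect_const]
    norm_num

end LowDegreeOnLines

section LineError

open Polynomial
open scoped BigOperators

variable {F V : Type*} [Field F] [Fintype F] [AddCommGroup V] [Module F V] [Fintype V]

theorem expect_expect_line (f : V → ℝ) : 𝔼 x, 𝔼 h, 𝔼 t : F, f (x + t • h) = 𝔼 x, f x := by
  rw [expect_swap]
  simp_rw [fun h => expect_swap (fun (x : V) (t : F) => f (x + t • h)), expect_add_const]
  simp

theorem one_le_add_of_ne {p q : F[X]} {d : ℕ} (hp : p.natDegree ≤ d) (hq : q.natDegree ≤ d)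
    (hne : p ≠ q) (f : F → F) :
    1 ≤ 𝔼 t, ind (p.eval t ≠ f t) + 𝔼 t, ind (f t ≠ q.eval t) + d / Fintype.card F := by
  have h1 : (Fintype.card F : ℝ) ≤ Fintype.card F * 𝔼 t, ind (p.eval t ≠ q.eval t) + d :=
    not_lt.1 fun h => hne (eq_of_expect_eval_ne hp hq h)
  have h2 : 𝔼 t, ind (p.eval t ≠ q.eval t) ≤
      𝔼 t, ind (p.eval t ≠ f t) + 𝔼 t, ind (f t ≠ q.eval t) := by
    rw [← expect_add]
    refine expect_mono fun t => ind_le_add fun h => ?_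
    by_contra! h'
    exact h (h'.1.trans h'.2)
  have h3 := card_field_pos (F := F)
  have h4 : 1 ≤ 𝔼 t, ind (p.eval t ≠ q.eval t) + d / Fintype.card F := by
    rw [← mul_le_mul_iff_right₀ h3, mul_add, mul_div_cancel₀ _ h3.ne']
    linarith
  linarith

/-- If `f` is `1/4`-close to a function of degree `d` on lines, then its distance to it is at most
twice the line test error. -/
theorem expect_ne_le_two_mul {d : ℕ} {f g : V → F} {P : V → V → F[X]}
    (hP : ∀ x h, (P x h).natDegree ≤ d)
    (hg : ∀ x h, ∃ p : F[X], p.natDegree ≤ d ∧ ∀ t : F, g (x + t • h) = p.eval t)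
    (hfg : 𝔼 x, ind (f x ≠ g x) ≤ 1 / 4) (hd : 8 * d ≤ Fintype.card F)
    (hF : 128 ≤ Fintype.card F) :
    𝔼 x, ind (f x ≠ g x) ≤
      2 * 𝔼 x, 𝔼 h, 𝔼 t : F, ind ((P x h).eval t ≠ f (x + t • h)) := by
  set τ := 𝔼 x, ind (f x ≠ g x) with hτ
  have hn := card_field_pos (F := F)
  have hτ0 : 0 ≤ τ := expect_ind_nonneg _
  let ρ : V → V → ℝ := fun x h => 𝔼 t : F, ind (f (x + t • h) ≠ g (x + t • h))
  have hρ : 𝔼 x, 𝔼 h, ρ x h = τ := expect_expect_line (fun x => ind (f x ≠ g x))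
  have hρ2 : 𝔼 x, 𝔼 h, ρ x h ^ 2 ≤ τ ^ 2 + (Fintype.card F : ℝ)⁻¹ * τ := by
    refine (expect_sq_expect_line_le (F := F) (fun x => ind (f x ≠ g x))).trans ?_
    have : ∀ x, ind (f x ≠ g x) ^ 2 = ind (f x ≠ g x) := fun x => by
      by_cases h : f x = g x <;> simp [ind, h]
    simp_rw [this]
    exact le_rfl
  have hdn : (d : ℝ) / Fintype.card F ≤ 1 / 8 := by
    rw [div_le_iff₀ hn]
    have : ((8 * d : ℕ) : ℝ) ≤ Fintype.card F := by exact_mod_cast hd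
    push_cast at this
    linarith
  have hline : ∀ x h, (1 + 128 * τ) * ρ x h - 64 * ρ x h ^ 2 - 64 * τ ^ 2 ≤
      𝔼 t : F, ind ((P x h).eval t ≠ f (x + t • h)) := by
    intro x h
    obtain ⟨p, hp, hpe⟩ := hg x h
    by_cases hpP : P x h = p
    · have : 𝔼 t : F, ind ((P x h).eval t ≠ f (x + t • h)) = ρ x h := by
        refine Finset.expect_congr rfl fun t _ => ind_congr ?_
        rw [hpP, hpe, ne_comm]
      rw [this]
      nlinarith [sq_nonneg (ρ x h - τ)]
    · have h1 := one_le_add_of_ne (hP x h) hp hpP (fun t => f (x + t • h))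
      simp_rw [← hpe] at h1
      have h2 : 7 / 8 - ρ x h ≤ 𝔼 t : F, ind ((P x h).eval t ≠ f (x + t • h)) := by
        simp only [ρ]
        linarith
      refine le_trans ?_ h2
      nlinarith [sq_nonneg (ρ x h - τ - 1 / 64)]
  have h1 := expect_mono fun x => expect_mono fun h => hline x h
  simp_rw [expect_sub, expect_const_mul, Fintype.expect_const, hρ] at h1
  have h2 : (Fintype.card F : ℝ)⁻¹ ≤ 1 / 128 := by
    rw [inv_le_comm₀ hn (by norm_num)]
    norm_num
    exact_mod_cast hF
  nlinarith

end LineError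

section DegreeReduction

open Polynomial
open scoped BigOperators

variable {F : Type*} [Field F] [Fintype F] {m : ℕ}

/-- A function of degree `k` on lines that correlates with a low-degree line table is a polynomial
of low total degree. -/
theorem exists_mvPolynomial_of_close {d k : ℕ} {f g : (Fin m → F) → F}
    {P : (Fin m → F) → (Fin m → F) → F[X]} (hdk : d ≤ k) (hk : 8 * k < Fintype.card F)
    (hP : ∀ x h, (P x h).natDegree ≤ d)
    (hg : ∀ x h, ∃ p : F[X], p.natDegree ≤ k ∧ ∀ t : F, g (x + t • h) = p.eval t)
    (hfg : 𝔼 x, ind (f x ≠ g x) ≤ 1 / 4)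
    (hfP : 𝔼 x, 𝔼 h, 𝔼 t : F, ind ((P x h).eval t ≠ f (x + t • h)) ≤ 1 / 8) :
    ∃ G : MvPolynomial (Fin m) F, G.totalDegree ≤ d ∧ ∀ x, MvPolynomial.eval x G = g x := by
  obtain ⟨G, hG, hGe⟩ := exists_mvPolynomial_of_lines (by lia) g hg
  refine ⟨G, totalDegree_le_of_expect_lines hG (by lia) ?_, hGe⟩
  simp_rw [hGe]
  have hn := card_field_pos (F := F)
  have hkn : (k : ℝ) / Fintype.card F < 1 / 8 := by
    rw [div_lt_iff₀ hn]
    have : ((8 * k : ℕ) : ℝ) < Fintype.card F := by exact_mod_cast hk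
    push_cast at this
    linarith
  let good : (Fin m → F) → (Fin m → F) → Prop := fun x h =>
    ∃ p : F[X], p.natDegree ≤ d ∧ ∀ t : F, g (x + t • h) = p.eval t
  have h1 : ∀ x h, 1 ≤ ind (good x h) + 4 / 3 *
      (𝔼 t : F, ind ((P x h).eval t ≠ f (x + t • h)) +
        𝔼 t : F, ind (f (x + t • h) ≠ g (x + t • h))) := by
    intro x h
    have h0 : 0 ≤ 𝔼 t : F, ind ((P x h).eval t ≠ f (x + t • h)) := expect_ind_nonneg _
    have h0' : 0 ≤ 𝔼 t : F, ind (f (x + t • h) ≠ g (x + t • h)) := expect_ind_nonneg _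
    obtain ⟨p, hp, hpe⟩ := hg x h
    by_cases hpP : P x h = p
    · rw [ind_pos ⟨p, hpP ▸ hP x h, hpe⟩]
      linarith
    · have h2 := one_le_add_of_ne ((hP x h).trans hdk) hp hpP (fun t => f (x + t • h))
      simp_rw [← hpe] at h2
      have := ind_nonneg (good x h)
      linarith
  have h2 := expect_mono fun h => expect_mono fun x => h1 x h
  simp_rw [expect_add, expect_const_mul, expect_add, Fintype.expect_const] at h2
  rw [expect_swap (fun h x => 𝔼 t : F, ind ((P x h).eval t ≠ f (x + t • h))),
    expect_swap (fun h x => 𝔼 t : F, ind (f (x + t • h) ≠ g (x + t • h))),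
    expect_expect_line (fun x => ind (f x ≠ g x))] at h2
  have h3 : 𝔼 h, 𝔼 x, ind (good x h) ≤ 𝔼 h, ind (∃ x, good x h) :=
    expect_mono fun h => expect_le_const fun x => ind_mono fun hx => ⟨x, hx⟩
  change 1 / 2 ≤ 𝔼 h, ind (∃ x, good x h)
  linarith

end DegreeReduction

section LineAverages

open scoped BigOperators

variable {F V : Type*} [Field F] [Fintype F] [AddCommGroup V] [Module F V] [Fintype V]

/-- For a function on lines with mean zero, the average over lines through a random point has small
second moment. -/
theorem expect_sq_expect_direction_le {e : V → V → ℝ} (he : ∀ x h (t : F), e (x + t • h) h = e x h)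
    (h0 : 𝔼 x, 𝔼 h, e x h = 0) (h1 : ∀ x h, e x h ^ 2 ≤ 1) :
    𝔼 x, (𝔼 h, e x h) ^ 2 ≤ (Fintype.card F : ℝ)⁻¹ := by
  set n := (Fintype.card F : ℝ)
  have hn0 : 0 < n := card_field_pos
  let ψ : V → ℝ := fun x => 𝔼 h, e x h
  have hψ : 𝔼 x, ψ x ^ 2 = 𝔼 x, 𝔼 h, e x h * 𝔼 t : F, ψ (x + t • h) := by
    have h2 : ∀ t : F, 𝔼 x, ψ x ^ 2 = 𝔼 x, 𝔼 h, e x h * ψ (x + t • h) := by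
      intro t
      have h3 : 𝔼 x, ψ x ^ 2 = 𝔼 h, 𝔼 x, e x h * ψ x := by
        rw [expect_swap]
        simp_rw [← Finset.expect_mul, sq]
        rfl
      rw [h3, expect_swap (fun x h => e x h * ψ (x + t • h))]
      refine Finset.expect_congr rfl fun h _ => ?_
      rw [← expect_add_const (t • h)]
      simp_rw [he]
    have h4 : 𝔼 x, ψ x ^ 2 = 𝔼 t : F, 𝔼 x, 𝔼 h, e x h * ψ (x + t • h) := by
      simp_rw [← h2]
      rw [Fintype.expect_const]
    rw [h4, expect_swap]
    refine Finset.expect_congr rfl fun x _ => ?_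
    rw [expect_swap]
    simp_rw [expect_const_mul]
  have hA := expect_sq_expect_line_le (F := F) ψ
  have hψ0 : 𝔼 x, ψ x = 0 := h0
  rw [hψ0] at hA
  have h5 : 𝔼 x, ψ x ^ 2 ≤ 𝔼 x : V, 𝔼 h, ((2 * n)⁻¹ + n / 2 * (𝔼 t : F, ψ (x + t • h)) ^ 2) := by
    rw [hψ]
    refine expect_mono fun x => expect_mono fun h => ?_
    have h6 : (2 * n)⁻¹ * e x h ^ 2 ≤ (2 * n)⁻¹ * 1 := by gcongr; exact h1 x h
    have h7 : 0 ≤ (2 * n)⁻¹ * (e x h - n * 𝔼 t : F, ψ (x + t • h)) ^ 2 := by positivity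
    have h8 : (2 * n)⁻¹ * (e x h - n * 𝔼 t : F, ψ (x + t • h)) ^ 2 = (2 * n)⁻¹ * e x h ^ 2 -
        e x h * (𝔼 t : F, ψ (x + t • h)) + n / 2 * (𝔼 t : F, ψ (x + t • h)) ^ 2 := by
      field_simp
      ring
    linarith
  simp_rw [expect_add, expect_const_mul, Fintype.expect_const] at h5
  have h9 : n / 2 * (𝔼 x, 𝔼 h, (𝔼 t : F, ψ (x + t • h)) ^ 2) ≤ n / 2 * (0 ^ 2 + n⁻¹ * 𝔼 x, ψ x ^ 2) :=
    by gcongr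
  have h10 : n / 2 * (0 ^ 2 + n⁻¹ * 𝔼 x, ψ x ^ 2) = (𝔼 x, ψ x ^ 2) / 2 := by field_simp; ring
  have h11 : (2 * n)⁻¹ = n⁻¹ / 2 := by rw [mul_inv]; ring
  change 𝔼 x, ψ x ^ 2 ≤ n⁻¹
  linarith

theorem expect_sq_expect_plane_le {e : V → V → ℝ} (he : ∀ x h (t : F), e (x + t • h) h = e x h)
    (h0 : 𝔼 x, 𝔼 h, e x h = 0) (h1 : ∀ x h, e x h ^ 2 ≤ 1) :
    𝔼 y, 𝔼 u, 𝔼 v, (𝔼 a : F, 𝔼 i : F, e (y + i • u) (v + a • u)) ^ 2 ≤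
      2 * (Fintype.card F : ℝ)⁻¹ := by
  have h2 : 𝔼 y, 𝔼 u, 𝔼 v, (𝔼 a : F, 𝔼 i : F, e (y + i • u) (v + a • u)) ^ 2 ≤
      𝔼 y : V, 𝔼 u : V, 𝔼 i : F, 𝔼 v, (𝔼 a : F, e (y + i • u) (v + a • u)) ^ 2 := by
    refine expect_mono fun y => expect_mono fun u => ?_
    rw [expect_swap (fun (i : F) v => (𝔼 a : F, e (y + i • u) (v + a • u)) ^ 2)]
    refine expect_mono fun v => ?_
    rw [expect_swap]
    exact sq_expect_le _
  have h3 : 𝔼 y : V, 𝔼 u : V, 𝔼 i : F, 𝔼 v, (𝔼 a : F, e (y + i • u) (v + a • u)) ^ 2 =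
      𝔼 y, 𝔼 v, 𝔼 u, (𝔼 a : F, e y (v + a • u)) ^ 2 := by
    simp_rw [fun y => expect_swap (fun v u => (𝔼 a : F, e y (v + a • u)) ^ 2)]
    rw [expect_swap, expect_swap (fun y u => 𝔼 v, (𝔼 a : F, e y (v + a • u)) ^ 2)]
    refine Finset.expect_congr rfl fun u _ => ?_
    rw [expect_swap]
    simp_rw [fun i : F => expect_add_const (i • u)
      (fun y => 𝔼 v, (𝔼 a : F, e y (v + a • u)) ^ 2)]
    rw [Fintype.expect_const]
  rw [h3] at h2
  have h4 : 𝔼 y, 𝔼 v, 𝔼 u, (𝔼 a : F, e y (v + a • u)) ^ 2 ≤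
      𝔼 y, ((𝔼 w, e y w) ^ 2 + (Fintype.card F : ℝ)⁻¹) := by
    refine expect_mono fun y => (expect_sq_expect_line_le (e y)).trans ?_
    have h5 : 𝔼 w, e y w ^ 2 ≤ 1 := expect_le_const fun w => h1 y w
    have h6 : (0 : ℝ) ≤ (Fintype.card F : ℝ)⁻¹ := by positivity
    nlinarith
  rw [expect_add, Fintype.expect_const] at h4
  linarith [expect_sq_expect_direction_le he h0 h1]

/-- Chebyshev's inequality. -/
theorem expect_ind_lt_le {ι : Type*} [Fintype ι] {g : ι → ℝ} {μ η σ : ℝ} (hη : 0 < η)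
    (hσ : 𝔼 i, (g i - μ) ^ 2 ≤ σ) : 𝔼 i, ind (μ + η < g i) ≤ σ / η ^ 2 := by
  rw [le_div_iff₀ (by positivity), mul_comm, ← expect_const_mul]
  refine (expect_mono fun i => ?_).trans hσ
  by_cases h : μ + η < g i
  · rw [ind_pos h]
    nlinarith
  · rw [ind_neg h]
    nlinarith [sq_nonneg (g i - μ)]

theorem expect_ind_lt_expect_plane_le {e : V → V → ℝ} {η : ℝ} (hη : 0 < η)
    (he : ∀ x h (t : F), e (x + t • h) h = e x h) (h0 : ∀ x h, 0 ≤ e x h) (h1 : ∀ x h, e x h ≤ 1) :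
    𝔼 z : V × V × V, ind ((𝔼 x, 𝔼 h, e x h) + η <
      𝔼 a : F, 𝔼 i : F, e (z.1 + i • z.2.1) (z.2.2 + a • z.2.1)) ≤
      2 * (Fintype.card F : ℝ)⁻¹ / η ^ 2 := by
  set μ := 𝔼 x, 𝔼 h, e x h with hμ
  have hμ0 : 0 ≤ μ := expect_nonneg' fun x => expect_nonneg' fun h => h0 x h
  have hμ1 : μ ≤ 1 := expect_le_const fun x => expect_le_const fun h => h1 x h
  refine expect_ind_lt_le hη ?_
  have h2 := expect_sq_expect_plane_le (F := F) (e := fun x h => e x h - μ)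
    (fun x h t => by rw [he]) (by simp_rw [expect_sub, Fintype.expect_const, ← hμ, sub_self])
    (fun x h => by nlinarith [h0 x h, h1 x h])
  simp_rw [expect_sub, Fintype.expect_const] at h2
  rw [expect_prod (fun y (z : V × V) =>
    (𝔼 a : F, 𝔼 i : F, e (y + i • z.1) (z.2 + a • z.1) - μ) ^ 2)]
  simp_rw [fun y => expect_prod (fun u v : V =>
    (𝔼 a : F, 𝔼 i : F, e (y + i • u) (v + a • u) - μ) ^ 2)]
  exact h2

theorem expect_ind_lt_expect_line_le {φ : V → ℝ} {η : ℝ} (hη : 0 < η) (h0 : ∀ x, 0 ≤ φ x)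
    (h1 : ∀ x, φ x ≤ 1) :
    𝔼 x, 𝔼 h, ind ((𝔼 x, φ x) + η < 𝔼 t : F, φ (x + t • h)) ≤
      (Fintype.card F : ℝ)⁻¹ / η ^ 2 := by
  set μ := 𝔼 x, φ x with hμ
  have hμ0 : 0 ≤ μ := expect_nonneg' h0
  have hμ1 : μ ≤ 1 := expect_le_const h1
  rw [← expect_prod (fun x h => ind (μ + η < 𝔼 t : F, φ (x + t • h)))]
  refine expect_ind_lt_le hη ?_
  rw [expect_prod (fun x h => (𝔼 t : F, φ (x + t • h) - μ) ^ 2)]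
  have h2 := expect_sq_expect_line_le (F := F) (fun x => φ x - μ)
  simp_rw [expect_sub, Fintype.expect_const, ← hμ, sub_self] at h2
  refine h2.trans ?_
  have h3 : 𝔼 x, (φ x - μ) ^ 2 ≤ 1 :=
    expect_le_const fun x => by nlinarith [h0 x, h1 x]
  have h4 : (0 : ℝ) ≤ (Fintype.card F : ℝ)⁻¹ := by positivity
  nlinarith

end LineAverages

section Plane

open Polynomial Polynomial.Bivariate
open scoped BigOperators

variable {F : Type*} [Field F]

/-- The restriction of a bivariate polynomial to an affine line. -/
theorem exists_evalEval_affine {Q : F[X][Y]} {k : ℕ} (h1 : Q.natDegree ≤ k)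
    (h2 : (swap Q).natDegree ≤ k) (α β γ δ : F) :
    ∃ q : F[X], q.natDegree ≤ 2 * k ∧
      ∀ t, q.eval t = Q.evalEval (β * t + α) (δ * t + γ) := by
  refine ⟨∑ j ∈ Finset.range (Q.natDegree + 1),
    (Q.coeff j).comp (C β * X + C α) * (C δ * X + C γ) ^ j, ?_, fun t => ?_⟩
  · refine natDegree_sum_le_of_forall_le _ _ fun j hj => ?_
    have h3 : (Q.coeff j).natDegree ≤ k := by
      refine natDegree_le_iff_coeff_eq_zero.2 fun i hi => ?_
      rw [← coeff_coeff_swap, coeff_eq_zero_of_natDegree_lt (h2.trans_lt hi), coeff_zero]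
    have h4 : ((Q.coeff j).comp (C β * X + C α)).natDegree ≤ k * 1 :=
      natDegree_comp_le.trans (Nat.mul_le_mul h3 natDegree_linear_le)
    have h5 : ((C δ * X + C γ) ^ j).natDegree ≤ j * 1 := natDegree_pow_le_of_le j natDegree_linear_le
    have h6 := Finset.mem_range.1 hj
    exact natDegree_mul_le.trans (by lia)
  · rw [eval_finsetSum, evalEval, eval_eq_sum_range (p := Q), eval_finsetSum]
    simp

variable [Fintype F]

theorem exists_bivariate_of_close {d : ℕ} {r c : F → F[X]} {φ : F → F → F} {ε : ℝ} (hε : 0 < ε)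
    (hε' : ε ≤ 1 / 8) (hd : d < ε * Fintype.card F) (hr : ∀ i, (r i).natDegree ≤ d)
    (hc : ∀ j, (c j).natDegree ≤ d)
    (h : 𝔼 i, 𝔼 j, ind ((r i).eval j ≠ φ i j) + 𝔼 i, 𝔼 j, ind ((c j).eval i ≠ φ i j) ≤ 1 / 4 - ε) :
    ∃ Q : F[X][Y], Q.natDegree ≤ d ∧ (swap Q).natDegree ≤ d ∧
      𝔼 i, 𝔼 j, ind (φ i j ≠ Q.evalEval i j) ≤ 1 / 2 - ε := by
  classical
  have hn := card_field_pos (F := F)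
  set n := Fintype.card F with hnF
  have he := Nat.floor_le (a := n * (1 / 2 - ε)) (by nlinarith)
  have he' := Nat.lt_floor_add_one ((n : ℝ) * (1 / 2 - ε))
  set e := ⌊(n : ℝ) * (1 / 2 - ε)⌋₊
  have hrc : 𝔼 i, 𝔼 j, ind ((r i).eval j ≠ (c j).eval i) ≤ 1 / 4 - ε := by
    refine le_trans ?_ h
    simp_rw [← expect_add]
    exact expect_mono fun i => expect_mono fun j => ind_ne_le_add _ _ _
  obtain ⟨Q, hQ1, hQ2, hQr, hQc⟩ := exists_bivariate_of_card_ne_lt (e := e) hr hc (by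
    have h1 := expect_prod fun i j => ind ((r i).eval j ≠ (c j).eval i)
    rw [← h1, expect_ind_eq, Fintype.card_prod, div_le_iff₀ (by positivity), ← hnF] at hrc
    have h3 : ((Finset.univ.filter fun p : F × F =>
        (r p.1).eval p.2 ≠ (c p.2).eval p.1).card : ℝ) < (e + 1) * (e + 1) := by
      refine hrc.trans_lt ?_
      push_cast
      have h4 : 0 < (n : ℝ) * (1 / 2 - ε) := by apply mul_pos hn; linarith
      have h5 : 0 < (n : ℝ) * n * ε ^ 2 := by positivity
      nlinarith
    exact_mod_cast h3) (by
      have : (2 * (e + d) : ℝ) < n := by linarith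
      exact_mod_cast this)
  refine ⟨Q, hQ1, hQ2, ?_⟩
  have hQr' : 𝔼 i, ind (Q.map (evalRingHom i) ≠ r i) ≤ 1 / 2 - ε := by
    rw [expect_ind_eq, div_le_iff₀ hn]
    have : ((Finset.univ.filter fun i => Q.map (evalRingHom i) ≠ r i).card : ℝ) ≤ e := by
      exact_mod_cast hQr
    linarith
  have hQc' : 𝔼 j, ind ((swap Q).map (evalRingHom j) ≠ c j) ≤ 1 / 2 - ε := by
    rw [expect_ind_eq, div_le_iff₀ hn]
    have : ((Finset.univ.filter fun j => (swap Q).map (evalRingHom j) ≠ c j).card : ℝ) ≤ e := by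
      exact_mod_cast hQc
    linarith
  have hpt : ∀ i j, ind (φ i j ≠ Q.evalEval i j) ≤ ind ((r i).eval j ≠ φ i j) +
      ind ((c j).eval i ≠ φ i j) +
      ind (Q.map (evalRingHom i) ≠ r i) * ind ((swap Q).map (evalRingHom j) ≠ c j) := by
    intro i j
    have h1 := ind_nonneg ((r i).eval j ≠ φ i j)
    have h2 := ind_nonneg ((c j).eval i ≠ φ i j)
    have h3 := ind_nonneg (Q.map (evalRingHom i) ≠ r i)
    have h4 := ind_nonneg ((swap Q).map (evalRingHom j) ≠ c j)
    refine ind_le_of_imp (by positivity) fun hne => ?_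
    by_cases hri : Q.map (evalRingHom i) = r i
    · have : (r i).eval j ≠ φ i j := by
        rw [← hri, eval_map_eval]
        exact hne.symm
      rw [ind_pos this]
      nlinarith
    by_cases hcj : (swap Q).map (evalRingHom j) = c j
    · have : (c j).eval i ≠ φ i j := by
        rw [← hcj, eval_map_eval, evalEval_swap]
        exact hne.symm
      rw [ind_pos this]
      nlinarith
    rw [ind_pos hri, ind_pos hcj]
    linarith
  have h1 := expect_mono fun i => expect_mono fun j => hpt i j
  simp_rw [expect_add, expect_const_mul, ← Finset.expect_mul] at h1
  have h2 := expect_ind_nonneg fun i => Q.map (evalRingHom i) ≠ r i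
  have h3 := expect_ind_nonneg fun j => (swap Q).map (evalRingHom j) ≠ c j
  have h4 := mul_le_mul hQr' hQc' h3 (by linarith)
  nlinarith

variable {V : Type*} [AddCommGroup V] [Module F V] {f : V → F} {C : V → V → F}

theorem IsBestFit.exists_plane {d : ℕ} {ε : ℝ} (hC : IsBestFit d f C) (hε : 0 < ε)
    (hε' : ε ≤ 1 / 8) (hd : d < ε * Fintype.card F) {y u v : V}
    (h : 𝔼 a : F, 𝔼 i : F, lineErr f C (y + i • u) (v + a • u) ≤ 1 / 8 - ε / 2) :
    ∃ G : F × F → F, (∀ p ω : F × F, ∃ q : F[X], q.natDegree ≤ 2 * d ∧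
        ∀ t : F, G (p + t • ω) = q.eval t) ∧
      𝔼 p : F × F, ind (f (y + p.1 • u + p.2 • v) ≠ G p) ≤ 1 / 2 - ε := by
  let α : F → ℝ := fun a => 𝔼 i : F, lineErr f C (y + i • u) (v + a • u)
  obtain ⟨a, ha⟩ : ∃ a, α a + α (a + 1) ≤ 1 / 4 - ε := by
    obtain ⟨a, ha⟩ := exists_le_expect fun a => α a + α (a + 1)
    rw [expect_add, expect_add_const 1 α] at ha
    exact ⟨a, by linarith⟩
  set w := v + a • u with hw
  set w' := v + (a + 1) • u with hw'
  choose r hr hre using fun i : F => hC.exists_poly (y + i • w') w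
  choose c hc hce using fun j : F => hC.exists_poly (y + j • w) w'
  obtain ⟨Q, hQ1, hQ2, hQ⟩ := exists_bivariate_of_close (φ := fun i j => f (y + i • w' + j • w))
    hε hε' hd hr hc (by
      have h1 : 𝔼 i, 𝔼 j, ind ((r i).eval j ≠ f (y + i • w' + j • w)) = α a := by
        refine Finset.expect_congr rfl fun i _ => ?_
        simp_rw [← hre]
        have : y + i • w' = y + i • u + i • w := by
          rw [hw, hw', add_smul, one_smul]
          module
        rw [← lineErr_add_smul _ w i, ← this]
        rfl
      have h2 : 𝔼 i, 𝔼 j, ind ((c j).eval i ≠ f (y + i • w' + j • w)) = α (a + 1) := by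
        rw [expect_swap]
        refine Fintype.expect_equiv (Equiv.neg F) _ _ fun j => ?_
        simp_rw [← hce]
        have : y + j • w = y + (-j) • u + j • w' := by
          rw [hw, hw']
          module
        rw [Equiv.neg_apply, ← lineErr_add_smul _ w' j, ← this]
        refine Finset.expect_congr rfl fun i _ => ?_
        rw [add_right_comm]
      rw [h1, h2]
      exact ha)
  refine ⟨fun p => Q.evalEval (p.1 - a * p.2) (p.2 - (p.1 - a * p.2)), fun p ω => ?_, ?_⟩
  · obtain ⟨q, hq, hqe⟩ := exists_evalEval_affine hQ1 hQ2 (p.1 - a * p.2) (ω.1 - a * ω.2)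
      (p.2 - (p.1 - a * p.2)) (ω.2 - (ω.1 - a * ω.2))
    refine ⟨q, hq, fun t => ?_⟩
    rw [hqe]
    simp only [Prod.fst_add, Prod.snd_add, Prod.smul_fst, Prod.smul_snd, smul_eq_mul]
    congr 1 <;> ring
  · refine le_trans (le_of_eq ?_) hQ
    rw [expect_prod (fun i j => ind (f (y + i • u + j • v) ≠
      Q.evalEval (i - a * j) (j - (i - a * j)))), expect_swap]
    simp_rw [fun j => (expect_add_const (a * j) fun i => ind (f (y + i • u + j • v) ≠
      Q.evalEval (i - a * j) (j - (i - a * j)))).symm, add_sub_cancel_right]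
    rw [expect_swap]
    refine Finset.expect_congr rfl fun i _ => ?_
    rw [← expect_add_const i]
    refine Finset.expect_congr rfl fun j _ => ?_
    rw [add_sub_cancel_right]
    congr 3
    rw [hw, hw']
    module

end Plane

section Consensus

open Polynomial
open scoped BigOperators

variable {F V : Type*} [Field F] [AddCommGroup V] [Module F V] {f : V → F}
  {C : V → V → F} {ε : ℝ}

theorem expect_plane_pair [Fintype V] {C : V → V → F} (p : F × F) {a : F} (ha : a ≠ 0) (b : F) :
    𝔼 z : V × V × V, ind (C (z.1 + p.1 • z.2.1 + p.2 • z.2.2) (a • z.2.1 + b • z.2.2) ≠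
      C (z.1 + p.1 • z.2.1 + p.2 • z.2.2) (a • z.2.1 + (b + 1) • z.2.2)) =
      𝔼 x, 𝔼 h, 𝔼 h', ind (C x h ≠ C x h') := by
  rw [expect_prod (fun y (z : V × V) => ind (C (y + p.1 • z.1 + p.2 • z.2) (a • z.1 + b • z.2) ≠
      C (y + p.1 • z.1 + p.2 • z.2) (a • z.1 + (b + 1) • z.2))), expect_swap]
  simp_rw [add_assoc, fun z : V × V => expect_add_const (p.1 • z.1 + p.2 • z.2) (fun y =>
    ind (C y (a • z.1 + b • z.2) ≠ C y (a • z.1 + (b + 1) • z.2)))]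
  rw [expect_swap]
  refine Finset.expect_congr rfl fun x _ => ?_
  rw [expect_prod (fun u v => ind (C x (a • u + b • v) ≠ C x (a • u + (b + 1) • v))), expect_swap]
  have h1 : ∀ v, 𝔼 u, ind (C x (a • u + b • v) ≠ C x (a • u + (b + 1) • v)) =
      𝔼 h, ind (C x h ≠ C x (h + v)) := by
    intro v
    rw [← expect_add_smul (b • v) ha fun h => ind (C x h ≠ C x (h + v))]
    refine Finset.expect_congr rfl fun u _ => ?_
    congr 3 <;> module
  simp_rw [h1]
  rw [expect_swap]
  exact Finset.expect_congr rfl fun h _ => expect_const_add h fun h' => ind (C x h ≠ C x h')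

variable [Fintype F]

theorem IsBestFit.expect_plane_ne_le {k : ℕ} (hC : IsBestFit k f C) (hε : 0 < ε)
    (hk : k < ε * Fintype.card F) {y u v : V} {G : F × F → F}
    (hG : ∀ p ω : F × F, ∃ q : F[X], q.natDegree ≤ k ∧ ∀ t : F, G (p + t • ω) = q.eval t)
    (h : 𝔼 p : F × F, ind (f (y + p.1 • u + p.2 • v) ≠ G p) ≤ 1 / 2 - ε) :
    𝔼 p : F × F, 𝔼 ω : F × F, ind (C (y + p.1 • u + p.2 • v) (ω.1 • u + ω.2 • v) ≠ G p) ≤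
      (Fintype.card F : ℝ)⁻¹ / (ε / 2) ^ 2 := by
  have hn := card_field_pos (F := F)
  refine le_trans (expect_mono fun p => expect_mono fun ω => ?_)
    (expect_ind_lt_expect_line_le (F := F) (half_pos hε)
      (φ := fun p : F × F => ind (f (y + p.1 • u + p.2 • v) ≠ G p)) (fun _ => ind_nonneg _)
      (fun _ => ind_le_one _))
  refine ind_mono fun hne => ?_
  by_contra hle
  obtain ⟨q, hq, hqe⟩ := hG p ω
  have hpt : ∀ t : F, y + (p + t • ω).1 • u + (p + t • ω).2 • v =
      y + p.1 • u + p.2 • v + t • (ω.1 • u + ω.2 • v) := by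
    intro t
    simp only [Prod.fst_add, Prod.snd_add, Prod.smul_fst, Prod.smul_snd, smul_eq_mul]
    module
  have h1 : 𝔼 t : F, ind (q.eval t ≠ f (y + p.1 • u + p.2 • v + t • (ω.1 • u + ω.2 • v))) ≤
      1 / 2 - ε / 2 := by
    refine le_trans (le_of_eq (Finset.expect_congr rfl fun t _ => ?_))
      ((not_lt.1 hle).trans (by linarith))
    rw [hqe, hpt]
    exact ind_congr ne_comm
  have h2 := hC.eq_eval (y + p.1 • u + p.2 • v) (ω.1 • u + ω.2 • v) q hq (by nlinarith) 0
  rw [← hqe, zero_smul, zero_smul, add_zero, add_zero] at h2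
  exact hne h2

theorem IsBestFit.expect_direction_ne_le [Fintype V] {d : ℕ} {C' : V → V → F} (hC : IsBestFit d f C)
    (hC' : IsBestFit (2 * d) f C') (hε : 0 < ε) (hε' : ε ≤ 1 / 8)
    (hd : (2 * d : ℕ) < ε * Fintype.card F) (h : 𝔼 x, 𝔼 h, lineErr f C x h ≤ 1 / 8 - ε) :
    𝔼 x, 𝔼 h, 𝔼 h', ind (C' x h ≠ C' x h') ≤ 48 * (Fintype.card F : ℝ)⁻¹ / ε ^ 2 := by
  have hn := card_field_pos (F := F)
  set n := (Fintype.card F : ℝ)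
  set bad : V × V × V → Prop := fun z => (𝔼 x, 𝔼 h, lineErr f C x h) + ε / 2 <
    𝔼 a : F, 𝔼 i : F, lineErr f C (z.1 + i • z.2.1) (z.2.2 + a • z.2.1)
  have hbad : 𝔼 z, ind (bad z) ≤ 2 * n⁻¹ / (ε / 2) ^ 2 :=
    expect_ind_lt_expect_plane_le (half_pos hε) lineErr_add_smul lineErr_nonneg lineErr_le_one
  have hG : ∀ z : V × V × V, ∃ G : F × F → F, 𝔼 p : F × F, 𝔼 ω : F × F,
      ind (C' (z.1 + p.1 • z.2.1 + p.2 • z.2.2) (ω.1 • z.2.1 + ω.2 • z.2.2) ≠ G p) ≤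
        ind (bad z) + n⁻¹ / (ε / 2) ^ 2 := by
    intro z
    by_cases hz : bad z
    · refine ⟨0, ?_⟩
      rw [ind_pos hz]
      have h1 : 0 ≤ n⁻¹ / (ε / 2) ^ 2 := by positivity
      refine le_trans (expect_le_const fun p => expect_ind_le_one _) (le_add_of_nonneg_right h1)
    · have hd' : (d : ℝ) < ε * Fintype.card F := by
        push_cast at hd
        have : (0 : ℝ) ≤ d := Nat.cast_nonneg d
        linarith
      obtain ⟨G, hGl, hGf⟩ := hC.exists_plane hε hε' hd' ((not_lt.1 hz).trans (by linarith))
      exact ⟨G, (hC'.expect_plane_ne_le hε hd hGl hGf).trans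
        (le_add_of_nonneg_left (ind_nonneg _))⟩
  choose G hG using hG
  set Ψ : F × F → ℝ := fun ω => 𝔼 z : V × V × V, 𝔼 p : F × F,
    ind (C' (z.1 + p.1 • z.2.1 + p.2 • z.2.2) (ω.1 • z.2.1 + ω.2 • z.2.2) ≠ G z p) with hΨ
  have hΨ1 : 𝔼 ω, Ψ ω ≤ 3 * n⁻¹ / (ε / 2) ^ 2 := by
    have h1 := expect_mono hG
    rw [expect_add, Fintype.expect_const] at h1
    rw [expect_swap]
    simp_rw [fun z : V × V × V => expect_swap fun (ω p : F × F) =>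
      ind (C' (z.1 + p.1 • z.2.1 + p.2 • z.2.2) (ω.1 • z.2.1 + ω.2 • z.2.2) ≠ G z p)]
    refine h1.trans ((add_le_add_left hbad _).trans (le_of_eq ?_))
    ring
  set κ := 𝔼 x, 𝔼 h, 𝔼 h', ind (C' x h ≠ C' x h') with hκ
  have hκ0 : 0 ≤ κ := expect_nonneg' fun x => expect_nonneg' fun h => expect_ind_nonneg _
  have hΨ2 : ∀ ω, κ ≤ Ψ ω + Ψ (ω + (0, 1)) + ind (ω.1 = 0) * κ := by
    intro ω
    by_cases hω : ω.1 = 0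
    · rw [ind_pos hω, one_mul]
      have h1 : ∀ ω, 0 ≤ Ψ ω := fun ω => expect_nonneg' fun z => expect_ind_nonneg _
      linarith [h1 ω, h1 (ω + (0, 1))]
    · rw [ind_neg hω, zero_mul, add_zero, hΨ]
      simp only [← expect_add]
      rw [← Fintype.expect_const (ι := F × F) κ,
        ← Finset.expect_congr rfl fun p _ => expect_plane_pair (C := C') p hω ω.2, expect_swap]
      refine expect_mono fun z => expect_mono fun p => ?_
      simpa using ind_ne_le_add _ _ _
  have h1 := expect_mono hΨ2
  have h2 : 𝔼 ω : F × F, ind (ω.1 = 0) = n⁻¹ := by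
    rw [expect_prod (fun a b : F => ind (a = 0))]
    simp_rw [Fintype.expect_const]
    exact expect_ind_eq_const 0
  simp_rw [expect_add, ← Finset.expect_mul, h2] at h1
  rw [expect_add_const (0, 1) Ψ, Fintype.expect_const] at h1
  have h3 : n⁻¹ ≤ 1 / 2 := by
    rw [inv_le_comm₀ hn (by norm_num)]
    norm_num
    change (2 : ℝ) ≤ Fintype.card F
    exact_mod_cast (Fintype.one_lt_card : 1 < Fintype.card F)
  have h4 : 3 * n⁻¹ / (ε / 2) ^ 2 = 12 * (n⁻¹ / ε ^ 2) := by field_simp; ring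
  have h5 : 48 * n⁻¹ / ε ^ 2 = 48 * (n⁻¹ / ε ^ 2) := by ring
  rw [h4] at hΨ1
  rw [h5]
  nlinarith

end Consensus

section LineTest

open Polynomial
open scoped BigOperators

variable {F V : Type*} [Field F] [Fintype F] [AddCommGroup V] [Module F V]

theorem IsBestFit.lineErr_le {k : ℕ} {f : V → F} {C : V → V → F} (hC : IsBestFit k f C)
    {C' : V → V → F} {x h : V}
    (hC' : ∃ p : F[X], p.natDegree ≤ k ∧ ∀ t : F, C' (x + t • h) h = p.eval t) :
    lineErr f C x h ≤ lineErr f C' x h := by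
  obtain ⟨p, hp, hpe⟩ := hC'
  simp only [lineErr, hpe]
  exact hC.le_of_natDegree_le x h p hp

/-- A function passing the line test with error below `1/8` is close to a function of degree `2 * d`
on lines. -/
theorem exists_close_of_lineTest [Fintype V] {ε : ℝ} (hε : 0 < ε) (hε' : ε ≤ 1 / 8) {d : ℕ}
    (hd : 1 ≤ d) (hn : 10 ^ 6 * d ≤ ε ^ 2 * Fintype.card F) {f : V → F} {P : V → V → F[X]}
    (hP : ∀ x h, (P x h).natDegree ≤ d)
    (h : 𝔼 x, 𝔼 h, 𝔼 t : F, ind ((P x h).eval t ≠ f (x + t • h)) ≤ 1 / 8 - ε) :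
    ∃ g : V → F, 𝔼 x, ind (f x ≠ g x) ≤ 1 / 4 ∧
      ∀ x h, ∃ p : F[X], p.natDegree ≤ 2 * d ∧ ∀ t : F, g (x + t • h) = p.eval t := by
  have hn0 := card_field_pos (F := F)
  have hd1 : (1 : ℝ) ≤ d := by exact_mod_cast hd
  obtain ⟨C, hC⟩ := exists_isBestFit d f
  obtain ⟨C₂, hC₂⟩ := exists_isBestFit (2 * d) f
  have hCerr : 𝔼 x, 𝔼 h, lineErr f C x h ≤ 1 / 8 - ε :=
    (expect_mono fun x => expect_mono fun h => hC.le_of_natDegree_le x h _ (hP x h)).trans h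
  have hd2 : ((2 * d : ℕ) : ℝ) < ε * Fintype.card F := by
    push_cast
    nlinarith
  have hκ := hC.expect_direction_ne_le hC₂ hε hε' hd2 hCerr
  set κ := 𝔼 x, 𝔼 h, 𝔼 h', ind (C₂ x h ≠ C₂ x h')
  have hdir : ∀ x, ∃ h', 𝔼 h, ind (C₂ x h ≠ C₂ x h') ≤ 𝔼 h, 𝔼 h', ind (C₂ x h ≠ C₂ x h') := by
    intro x
    rw [expect_swap]
    exact exists_le_expect _
  choose w hw using hdir
  let f' : V → F := fun x => C₂ x (w x)
  have hf' : 𝔼 x, 𝔼 h, ind (C₂ x h ≠ f' x) ≤ κ := expect_mono hw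
  obtain ⟨C', hC'⟩ := exists_isBestFit (2 * d) f'
  have hC'err : 𝔼 x, 𝔼 h, ind (C' x h ≠ f' x) ≤ κ := by
    rw [← expect_lineErr] at hf' ⊢
    exact (expect_mono fun x => expect_mono fun h =>
      hC'.lineErr_le (hC₂.exists_poly x h)).trans hf'
  have hff' : 𝔼 x, ind (f x ≠ f' x) ≤ 1 / 8 + κ := by
    have h1 : 𝔼 x, 𝔼 h, ind (C₂ x h ≠ f x) ≤ 1 / 8 := by
      rw [← expect_lineErr]
      refine (expect_mono fun x => expect_mono fun h => hC₂.lineErr_le ?_).trans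
        (hCerr.trans (by linarith))
      obtain ⟨p, hp, hpe⟩ := hC.exists_poly x h
      exact ⟨p, by lia, hpe⟩
    have h2 : 𝔼 x, ind (f x ≠ f' x) ≤
        𝔼 x, (𝔼 h, ind (C₂ x h ≠ f x) + 𝔼 h, ind (C₂ x h ≠ f' x)) := by
      refine expect_mono fun x => ?_
      rw [← expect_add, ← Fintype.expect_const (ι := V) (ind (f x ≠ f' x))]
      refine expect_mono fun h => ind_le_add fun hne => ?_
      by_contra! hcon
      exact hne (hcon.1.symm.trans hcon.2)
    rw [expect_add] at h2
    linarith
  have hsmall : κ + (Fintype.card F : ℝ)⁻¹ ≤ 1 / 4000 := by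
    have h1 : (Fintype.card F : ℝ)⁻¹ ≤ ε ^ 2 / 10 ^ 6 := by
      rw [inv_le_comm₀ hn0 (by positivity), inv_div, div_le_iff₀ (by positivity)]
      linarith
    have h2 : 48 * (Fintype.card F : ℝ)⁻¹ / ε ^ 2 ≤ 48 / 10 ^ 6 := by
      rw [div_le_iff₀ (by positivity)]
      linarith
    nlinarith
  obtain ⟨g, hg, hgl⟩ := exists_poly_on_lines hC' (by
    have : ((8 * (2 * d) : ℕ) : ℝ) ≤ Fintype.card F := by
      push_cast
      nlinarith
    exact_mod_cast this) hC'err hsmall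
  refine ⟨g, ?_, hgl⟩
  have h1 : 𝔼 x, ind (f x ≠ g x) ≤ 𝔼 x, (ind (f x ≠ f' x) + ind (f' x ≠ g x)) := by
    refine expect_mono fun x => ind_le_add fun hne => ?_
    by_contra! hcon
    exact hne (hcon.1.trans hcon.2)
  rw [expect_add] at h1
  have h2 : 0 ≤ (Fintype.card F : ℝ)⁻¹ := by positivity
  linarith

/-- The averaged form of the efficiency of the low-degree test. -/
theorem exists_mvPolynomial_of_lineTest {m : ℕ} {ε : ℝ} (hε : 0 < ε) (hε' : ε ≤ 1 / 8) {d : ℕ}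
    (hd : 1 ≤ d) (hn : 10 ^ 6 * d ≤ ε ^ 2 * Fintype.card F) {f : (Fin m → F) → F}
    {P : (Fin m → F) → (Fin m → F) → F[X]} (hP : ∀ x h, (P x h).natDegree ≤ d)
    (h : 𝔼 x, 𝔼 h, 𝔼 t : F, ind ((P x h).eval t ≠ f (x + t • h)) ≤ 1 / 8 - ε) :
    ∃ G : MvPolynomial (Fin m) F, G.totalDegree ≤ d ∧
      𝔼 x, ind (f x ≠ MvPolynomial.eval x G) ≤
        2 * 𝔼 x, 𝔼 h, 𝔼 t : F, ind ((P x h).eval t ≠ f (x + t • h)) := by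
  have hn0 := card_field_pos (F := F)
  have hd1 : (1 : ℝ) ≤ d := by exact_mod_cast hd
  have hcard : 128 * d ≤ Fintype.card F := by
    have h1 : ε ^ 2 * Fintype.card F ≤ 1 * Fintype.card F := by
      gcongr
      nlinarith
    have : ((128 * d : ℕ) : ℝ) ≤ Fintype.card F := by
      push_cast
      linarith
    exact_mod_cast this
  obtain ⟨g, hfg, hgl⟩ := exists_close_of_lineTest hε hε' hd hn hP h
  obtain ⟨G, hG, hGe⟩ := exists_mvPolynomial_of_close (by lia) (by lia) hP hgl hfg
    (h.trans (by linarith))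
  refine ⟨G, hG, ?_⟩
  simp_rw [hGe]
  refine expect_ne_le_two_mul hP (fun x h => ⟨G.lineRestriction x h,
    (G.natDegree_lineRestriction_le x h).trans hG, fun t => ?_⟩) hfg (by lia) (by lia)
  rw [MvPolynomial.eval_lineRestriction, hGe]

theorem expect_lineTest_eq [DecidableEq F] {m : ℕ} (f : (Fin m → F) → F)
    (P : (Fin m → F) → (Fin m → F) → F[X]) :
    𝔼 x, 𝔼 h, 𝔼 t : F, ind ((P x h).eval t ≠ f (x + t • h)) =
      ((Finset.univ.filter fun z : (Fin m → F) × (Fin m → F) × F =>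
        (P z.1 z.2.1).eval z.2.2 ≠ f (z.1 + z.2.2 • z.2.1)).card : ℝ) /
          (Fintype.card F : ℝ) ^ (2 * m + 1) := by
  simp_rw [fun x => (expect_prod fun h (t : F) => ind ((P x h).eval t ≠ f (x + t • h))).symm]
  rw [← expect_prod fun x (z : (Fin m → F) × F) => ind ((P x z.1).eval z.2 ≠ f (x + z.2 • z.1)),
    expect_ind_eq]
  simp only [Fintype.card_prod, Fintype.card_fun, Fintype.card_fin]
  push_cast
  congr 1
  ring

end LineTest

/-- For every `ε > 0` there is a constant `c > 0` such that for all
`d ≥ 1`, `m ≥ 1`, and every finite field `F` with `|F| ≥ c·d`: if `f : F^m → F` and a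
family `P` of univariate polynomials of degree at most `d` indexed by pairs `(x,h)`
satisfy `Pr_{x,h,t}[P_{x,h}(t) ≠ f(x + t·h)] = δ` with `δ ≤ 1/8 - ε`, then `f` is
within distance `2δ` of the evaluation of some polynomial of total degree at most
`d`. -/
theorem low_degree_test_efficiency (ε : ℝ) (hε : 0 < ε) :
    ∃ c : ℝ, 0 < c ∧
    ∀ (F : Type) [Field F] [Fintype F] [DecidableEq F] (d m : ℕ),
      1 ≤ d → 1 ≤ m → c * (d : ℝ) ≤ (Fintype.card F : ℝ) →
      ∀ (f : (Fin m → F) → F)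
        (P : (Fin m → F) → (Fin m → F) → Polynomial F),
        (∀ x h : Fin m → F, (P x h).natDegree ≤ d) →
      ∀ δ : ℝ,
        ((Finset.univ.filter fun z : (Fin m → F) × (Fin m → F) × F =>
            (P z.1 z.2.1).eval z.2.2 ≠ f (z.1 + z.2.2 • z.2.1)).card : ℝ) /
          (Fintype.card F : ℝ) ^ (2 * m + 1) = δ →
        δ ≤ 1 / 8 - ε →
      ∃ g : (Fin m → F) → F,
        (∃ Pg : MvPolynomial (Fin m) F, Pg.totalDegree ≤ d ∧
          ∀ y : Fin m → F, MvPolynomial.eval y Pg = g y) ∧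
        ((Finset.univ.filter fun x : Fin m → F => f x ≠ g x).card : ℝ) /
          (Fintype.card F : ℝ) ^ m ≤ 2 * δ := by
  set η := min ε (1 / 8) with hη
  have hη0 : 0 < η := lt_min hε (by norm_num)
  refine ⟨10 ^ 6 / η ^ 2, by positivity, ?_⟩
  intro F _ _ _ d m hd _ hn f P hP δ hδ hδε
  rw [div_mul_eq_mul_div, div_le_iff₀ (by positivity), mul_comm (Fintype.card F : ℝ)] at hn
  have hδ' := (expect_lineTest_eq f P).trans hδ
  obtain ⟨G, hG, hfG⟩ := exists_mvPolynomial_of_lineTest hη0 (min_le_right _ _) hd hn hP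
    (hδ'.le.trans (hδε.trans (by linarith [min_le_left ε (1 / 8)])))
  refine ⟨fun x => MvPolynomial.eval x G, ⟨G, hG, fun _ => rfl⟩, ?_⟩
  rw [hδ', expect_ind_eq] at hfG
  simpa using hfG
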